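/- Let q be an odd prime power and let (a,b) be a valid pair in F_q^2 with a ≠ b. Then every autotopism of the quadratic quasigroup Q_{a,b} is an automorphism; that is, if α, β, γ are permutations of F_q with α(x)*β(y) = γ(x*y) for all x, y ∈ F_q, then α = β = γ. -/

import Mathlib

open scoped Classical
open Finset

noncomputable section

variable {F : Type*} [Field F] [Fintype F]

/-- `x ∈ R_q`: `x` is a nonzero square in `F`. -/
def inR (x : F) : Prop := x ≠ 0 ∧ IsSquare x

/-- `x ∈ N_q`: `x` is a nonzero non-square in `F`. -/
def inN (x : F) : Prop := x ≠ 0 ∧ ¬ IsSquare x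

/-- `(a, b)` is a valid pair: `ab ∈ R_q` and `(a-1)(b-1) ∈ R_q`. -/
def ValidPair (a b : F) : Prop := inR (a * b) ∧ inR ((a - 1) * (b - 1))

/-- The operation of the quadratic quasigroup `Q_{a,b}`:
`x*y = x + a(y-x)` if `y - x ∈ R_q`, `x*y = x + b(y-x)` if `y - x ∈ N_q`, and `x*x = x`. -/
def qmul (a b x y : F) : F :=
  if inR (y - x) then x + a * (y - x) else x + b * (y - x)

set_option linter.unusedSectionVars false

/-! ### Character sums -/

/-- The quadratic character. -/
def chi (x : F) : ℤ := quadraticChar F x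

theorem chi_cases (x : F) : chi x = 0 ∨ chi x = 1 ∨ chi x = -1 :=
  quadraticChar_isQuadratic F x

theorem chi_ne_zero {x : F} (hx : x ≠ 0) : chi x = 1 ∨ chi x = -1 := quadraticChar_dichotomy hx

theorem chi_zero : chi (0 : F) = 0 := by simp [chi]

theorem chi_eq_zero {x : F} : chi x = 0 ↔ x = 0 := quadraticChar_eq_zero_iff

theorem chi_mul (x y : F) : chi (x * y) = chi x * chi y := map_mul _ _ _

theorem chi_sq {x : F} (hx : x ≠ 0) : chi x * chi x = 1 := by
  rcases chi_ne_zero hx with h | h <;> simp [h]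

theorem inR_iff {x : F} : inR x ↔ chi x = 1 := by
  unfold inR
  constructor
  · rintro ⟨h, h'⟩
    exact (quadraticChar_one_iff_isSquare h).2 h'
  · intro h
    have hx : x ≠ 0 := by
      rintro rfl
      simp [chi] at h
    exact ⟨hx, (quadraticChar_one_iff_isSquare hx).1 h⟩

theorem sum_chi_mul_sub (h2 : ringChar F ≠ 2) {c : F} (hc : c ≠ 0) :
    ∑ z : F, chi z * chi (c - z) = - chi (-1 : F) := by
  have h := jacobiSum_nontrivial_inv (quadraticChar_ne_one h2)
  rw [(quadraticChar_isQuadratic F).inv] at h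
  change _ = - (quadraticChar F) (-1)
  rw [← h, jacobiSum, ← Equiv.sum_comp (Equiv.mulLeft₀ c hc)]
  refine Finset.sum_congr rfl fun z _ => ?_
  have : c - c * z = c * (1 - z) := by ring
  change _ = chi z * chi (1 - z)
  change chi (c * z) * chi (c - c * z) = _
  rw [this, chi_mul, chi_mul]
  have := chi_sq hc
  linear_combination (chi z * chi (1 - z)) * this

theorem sum_chi_shift (h2 : ringChar F ≠ 2) (x : F) : ∑ z : F, chi (z - x) = 0 := by
  rw [← quadraticChar_sum_zero h2]
  exact (Equiv.subRight x).sum_comp (fun z => chi z)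

theorem sum_chi_chi (h2 : ringChar F ≠ 2) (x y : F) :
    ∑ z : F, chi (z - x) * chi (y - z) =
      chi (-1 : F) * (if x = y then (Fintype.card F : ℤ) - 1 else -1) := by
  rw [← Equiv.sum_comp (Equiv.addRight x)]
  simp only [Equiv.coe_addRight, add_sub_cancel_right]
  split_ifs with h
  · subst h
    have : ∀ z : F, chi z * chi (x - (z + x)) = chi (-1 : F) * (if z = 0 then 0 else 1) := by
      intro z
      have : x - (z + x) = -1 * z := by ring
      rw [this, chi_mul]
      split_ifs with hz
      · simp [hz, chi_zero]
      · linear_combination chi (-1 : F) * chi_sq hz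
    rw [Finset.sum_congr rfl fun z _ => this z, ← Finset.mul_sum]
    congr 1
    rw [Finset.sum_ite]
    simp only [Finset.sum_const_zero, zero_add, Finset.sum_const, nsmul_eq_mul, mul_one]
    have h3 : (Finset.univ.filter fun z : F => ¬ z = 0) = Finset.univ.erase 0 := by
      ext; simp
    have : 1 ≤ Fintype.card F := Fintype.card_pos
    rw [h3, Finset.card_erase_of_mem (Finset.mem_univ _), Finset.card_univ]
    push_cast [this]
    ring
  · have hc : y - x ≠ 0 := sub_ne_zero.2 (Ne.symm h)
    have := sum_chi_mul_sub h2 hc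
    rw [mul_neg_one, ← this]
    refine Finset.sum_congr rfl fun z _ => ?_
    congr 2; ring

/-! ### The matrix argument -/

/-- The Paley type matrix. -/
def Smat (F : Type*) [Field F] [Fintype F] : Matrix F F ℤ := Matrix.of fun x y => chi (y - x)

/-- The all-ones matrix. -/
def Jmat (F : Type*) [Field F] [Fintype F] : Matrix F F ℤ := Matrix.of fun _ _ => 1

theorem S_mul_S (h2 : ringChar F ≠ 2) :
    Smat F * Smat F = chi (-1 : F) • ((Fintype.card F : ℤ) • 1 - Jmat F) := by
  ext x y
  simp only [Matrix.mul_apply, Smat, Jmat, Matrix.of_apply, Matrix.smul_apply, Matrix.sub_apply,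
    smul_eq_mul, Matrix.one_apply]
  rw [sum_chi_chi h2]
  split_ifs <;> ring

theorem S_mul_J (h2 : ringChar F ≠ 2) : Smat F * Jmat F = 0 := by
  ext x y
  simp [Matrix.mul_apply, Smat, Jmat, sum_chi_shift h2]

theorem S_transpose : (Smat F).transpose = chi (-1 : F) • Smat F := by
  ext x y
  simp only [Smat, Matrix.transpose_apply, Matrix.of_apply, Matrix.smul_apply, smul_eq_mul]
  rw [← chi_mul]; congr 1; ring

/-- The `±1` matrix `I + η S`. -/
def Bmat (F : Type*) [Field F] [Fintype F] (η : ℤ) : Matrix F F ℤ := 1 + η • Smat F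

theorem chi_neg_one_sq : chi (-1 : F) * chi (-1 : F) = 1 := chi_sq (by simp)

theorem B_transpose (η : ℤ) : (Bmat F η).transpose = Bmat F (η * chi (-1 : F)) := by
  rw [Bmat, Matrix.transpose_add, Matrix.transpose_smul, S_transpose, smul_smul]
  simp [Bmat]

theorem B_mul_transpose (h2 : ringChar F ≠ 2) {η : ℤ} (hη : η * η = 1) :
    Bmat F η * (Bmat F η).transpose =
      ((Fintype.card F : ℤ) + 1) • 1 - Jmat F + (η * (1 + chi (-1 : F))) • Smat F := by
  rw [B_transpose, Bmat, Bmat, add_mul, mul_add, mul_add, smul_mul_smul_comm, S_mul_S h2]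
  have h := chi_neg_one_sq (F := F)
  have : η * (η * chi (-1 : F)) * chi (-1 : F) = 1 := by
    linear_combination chi (-1 : F) ^ 2 * hη + h
  rw [smul_smul, this]
  simp only [one_mul, mul_one]
  module

theorem B_rows (h2 : ringChar F ≠ 2) (hq : 3 < Fintype.card F) {η : ℤ} (hη : η * η = 1) {x y : F}
    (h : ∀ z, Bmat F η x z = Bmat F η y z) : x = y := by
  by_contra hxy
  have h1 : (Bmat F η * (Bmat F η).transpose) x x = (Bmat F η * (Bmat F η).transpose) x y := by
    simp only [Matrix.mul_apply, Matrix.transpose_apply, h]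
  rw [B_mul_transpose h2 hη] at h1
  simp only [Matrix.add_apply, Matrix.sub_apply, Matrix.smul_apply, Matrix.one_apply, Jmat, Smat,
    Matrix.of_apply, smul_eq_mul, hxy, if_true, if_false, sub_self, chi_zero] at h1
  have hη' : η = 1 ∨ η = -1 := mul_self_eq_one_iff.1 hη
  have hq' : (3 : ℤ) < Fintype.card F := by exact_mod_cast hq
  rcases hη' with rfl | rfl <;> rcases chi_cases (-1 : F) with h3 | h3 | h3 <;>
    rcases chi_cases (y - x) with h4 | h4 | h4 <;> rw [h3, h4] at h1 <;> simp at h1 <;> linarith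

theorem B_cols (h2 : ringChar F ≠ 2) (hq : 3 < Fintype.card F) {η : ℤ} (hη : η * η = 1) {x y : F}
    (h : ∀ z, Bmat F η z x = Bmat F η z y) : x = y := by
  have h' : (η * chi (-1 : F)) * (η * chi (-1 : F)) = 1 := by
    linear_combination chi (-1 : F) ^ 2 * hη + chi_neg_one_sq (F := F)
  apply B_rows h2 hq h'
  intro z
  rw [← B_transpose]
  exact h z

/-- `M` is preserved when rows are permuted by `α` and columns by `β`. -/
def Pres (M : Matrix F F ℤ) (α β : Equiv.Perm F) : Prop := M.submatrix α β = M

theorem Pres.mul {M N : Matrix F F ℤ} {α β γ : Equiv.Perm F} (h : Pres M α β) (h' : Pres N β γ) :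
    Pres (M * N) α γ := by
  unfold Pres at *
  rw [← Matrix.submatrix_mul_equiv M N α β γ, h, h']

theorem Pres.transpose {M : Matrix F F ℤ} {α β : Equiv.Perm F} (h : Pres M α β) :
    Pres M.transpose β α := by
  unfold Pres at *
  rw [← Matrix.transpose_submatrix, h]

theorem pres_one (α : Equiv.Perm F) : Pres (1 : Matrix F F ℤ) α α := by
  unfold Pres
  exact Matrix.submatrix_one_equiv α

theorem pres_J (α β : Equiv.Perm F) : Pres (Jmat F) α β := by
  unfold Pres Jmat
  ext; simp

theorem Pres.add {M N : Matrix F F ℤ} {α β : Equiv.Perm F} (h : Pres M α β) (h' : Pres N α β) :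
    Pres (M + N) α β := by
  unfold Pres at *
  rw [Matrix.submatrix_add]; simp [h, h']

theorem Pres.smul {M : Matrix F F ℤ} {α β : Equiv.Perm F} (h : Pres M α β) (c : ℤ) :
    Pres (c • M) α β := by
  unfold Pres at *
  rw [Matrix.submatrix_smul]; simp [h]

theorem Pres.of_smul {M : Matrix F F ℤ} {α β : Equiv.Perm F} {c : ℤ} (hc : c ≠ 0)
    (h : Pres (c • M) α β) : Pres M α β := by
  unfold Pres at *
  ext x y
  have := congrFun (congrFun h x) y
  simp only [Matrix.submatrix_apply, Matrix.smul_apply, smul_eq_mul] at this ⊢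
  exact mul_left_cancel₀ hc this

theorem Pres.sub {M N : Matrix F F ℤ} {α β : Equiv.Perm F} (h : Pres M α β) (h' : Pres N α β) :
    Pres (M - N) α β := by
  unfold Pres at *
  rw [Matrix.submatrix_sub]; simp [h, h']

theorem pres_B_iff {η : ℤ} (hη : η * η = 1) (α : Equiv.Perm F) :
    Pres (Bmat F η) α α ↔ Pres (Smat F) α α := by
  have h0 : η ≠ 0 := by rintro rfl; simp at hη
  constructor
  · intro h
    have := h.sub (pres_one α)
    rw [Bmat, add_sub_cancel_left] at this
    exact this.of_smul h0
  · intro h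
    exact (pres_one α).add (h.smul η)

theorem Pres.unique_right (h2 : ringChar F ≠ 2) (hq : 3 < Fintype.card F) {η : ℤ} (hη : η * η = 1)
    {α β γ : Equiv.Perm F} (h : Pres (Bmat F η) α β) (h' : Pres (Bmat F η) α γ) : β = γ := by
  ext x
  apply B_cols h2 hq hη
  intro z
  obtain ⟨z, rfl⟩ := α.surjective z
  have e1 := congrFun (congrFun h z) x
  have e2 := congrFun (congrFun h' z) x
  simp only [Matrix.submatrix_apply] at e1 e2
  rw [e1, e2]

theorem Pres.unique_left (h2 : ringChar F ≠ 2) (hq : 3 < Fintype.card F) {η : ℤ} (hη : η * η = 1)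
    {α β γ : Equiv.Perm F} (h : Pres (Bmat F η) β α) (h' : Pres (Bmat F η) γ α) : β = γ := by
  ext x
  apply B_rows h2 hq hη
  intro z
  obtain ⟨z, rfl⟩ := α.surjective z
  have e1 := congrFun (congrFun h x) z
  have e2 := congrFun (congrFun h' x) z
  simp only [Matrix.submatrix_apply] at e1 e2
  rw [e1, e2]

/-- The key matrix argument: an autotopism preserving the three Paley type relations has `α = β`. -/
theorem matrix_argument (h2 : ringChar F ≠ 2) (hq : 3 < Fintype.card F) {η ε δ : ℤ}
    (hη : η * η = 1) (hε : ε = 1 ∨ ε = -1) (hδ : δ = 1 ∨ δ = -1) {α β γ : Equiv.Perm F}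
    (h1 : Pres (Bmat F η) α β) (h3 : Pres (Bmat F (η * ε)) α γ)
    (h4 : Pres (Bmat F (η * δ)) γ β) : α = β := by
  have hc : chi (-1 : F) = 1 ∨ chi (-1 : F) = -1 := chi_ne_zero (by simp)
  have hη0 : η ≠ 0 := by rintro rfl; simp at hη
  -- it suffices to preserve `S`
  have key : Pres (Smat F) α α → α = β := fun h =>
    ((pres_B_iff hη α).2 h).unique_right h2 hq hη h1
  have hηδ : (η * δ) * (η * δ) = 1 := by
    rcases hδ with rfl | rfl <;> linear_combination hη
  have hηε : (η * ε) * (η * ε) = 1 := by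
    rcases hε with rfl | rfl <;> linear_combination hη
  rcases hc with hc | hc
  · have h5 := h1.mul h1.transpose
    rw [B_mul_transpose h2 hη, hc] at h5
    have h6 := h5.sub (((pres_one α).smul ((Fintype.card F : ℤ) + 1)).sub (pres_J α α))
    rw [add_sub_cancel_left] at h6
    exact key (h6.of_smul (by simpa using hη0))
  · rcases hε with rfl | rfl
    · rw [mul_one] at h3
      obtain rfl := h1.unique_right h2 hq hη h3
      have h5 := (pres_B_iff hη β).2 ((pres_B_iff hηδ β).1 h4)
      exact h1.unique_left h2 hq hη h5
    · rcases hδ with rfl | rfl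
      · rw [mul_one] at h4
        obtain rfl := h1.unique_left h2 hq hη h4
        exact key ((pres_B_iff hηε α).1 h3)
      · have h3' := h3.transpose
        have h4' := h4.transpose
        rw [B_transpose, hc] at h3' h4'
        have e : η * -1 * -1 = η := by ring
        rw [e] at h3' h4'
        have h5 := (h1.mul h4').mul h3'
        have hS := S_mul_S h2 (F := F)
        have hSJ := S_mul_J h2 (F := F)
        rw [hc] at hS
        have hB : Bmat F η * Bmat F η * Bmat F η =
            (1 - 3 * (Fintype.card F : ℤ)) • 1 + (3 : ℤ) • Jmat F +
              (η * (3 - (Fintype.card F : ℤ))) • Smat F := by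
          have hS2 : Smat F * Smat F = Jmat F - (Fintype.card F : ℤ) • 1 := by
            rw [hS]; module
          have e1 : Bmat F η * Bmat F η = (1 - (Fintype.card F : ℤ)) • 1 + Jmat F +
              (2 * η) • Smat F := by
            rw [Bmat, add_mul, mul_add, mul_add, smul_mul_smul_comm, hS2, hη]
            simp only [one_mul, mul_one]
            module
          have hJS : Jmat F * Smat F = 0 := by
            have := congrArg Matrix.transpose hSJ
            rw [Matrix.transpose_mul, S_transpose, hc] at this
            have hJ : (Jmat F).transpose = Jmat F := by ext; simp [Jmat]
            rw [hJ] at this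
            simpa using this
          rw [e1, Bmat, mul_add, mul_one, mul_smul_comm, add_mul, add_mul, hJS, smul_mul_assoc,
            smul_mul_assoc, hS2, one_mul]
          have : η * (2 * η) = 2 := by linear_combination 2 * hη
          simp only [smul_add, smul_smul, smul_sub, add_zero, this]
          rw [← mul_assoc, this]
          module
        rw [hB] at h5
        have h6 := h5.sub (((pres_one α).smul (1 - 3 * (Fintype.card F : ℤ))).add
          ((pres_J α α).smul 3))
        rw [add_sub_cancel_left] at h6
        refine key (h6.of_smul (mul_ne_zero hη0 ?_))
        have hq' : (3 : ℤ) < Fintype.card F := by exact_mod_cast hq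
        linarith
set_option linter.unusedSectionVars false

/-! ### The map `φ` with `x * y = x + φ (y - x)` -/

/-- The map `φ` with `x * y = x + φ (y - x)`. -/
def ph (a b w : F) : F := if inR w then a * w else b * w

theorem qmul_eq (a b x y : F) : qmul a b x y = x + ph a b (y - x) := by
  unfold qmul ph
  split_ifs <;> rfl

theorem ph_zero (a b : F) : ph a b 0 = 0 := by unfold ph; split_ifs <;> simp

theorem ph_pos {a b w : F} (h : chi w = 1) : ph a b w = a * w := by
  unfold ph; rw [if_pos (inR_iff.2 h)]

theorem ph_neg {a b w : F} (h : chi w = -1) : ph a b w = b * w := by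
  unfold ph; rw [if_neg]; rw [inR_iff, h]; norm_num

theorem ph_two (a b w : F) : 2 * ph a b w = (a + b) * w + (a - b) * (w * (chi w : F)) := by
  rcases chi_cases w with h | h | h
  · rw [chi_eq_zero] at h; simp [h, ph_zero]
  · rw [ph_pos h, h]; push_cast; ring
  · rw [ph_neg h, h]; push_cast; ring

theorem two_ne (h2 : ringChar F ≠ 2) : (2 : F) ≠ 0 := Ring.two_ne_zero h2

theorem ValidPair.ne {a b : F} (hv : ValidPair a b) : a ≠ 0 ∧ b ≠ 0 ∧ 1 - a ≠ 0 ∧ 1 - b ≠ 0 := by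
  obtain ⟨⟨h1, _⟩, ⟨h3, _⟩⟩ := hv
  refine ⟨left_ne_zero_of_mul h1, right_ne_zero_of_mul h1, ?_, ?_⟩
  · intro h; exact left_ne_zero_of_mul h3 (by linear_combination -h)
  · intro h; exact right_ne_zero_of_mul h3 (by linear_combination -h)

theorem ValidPair.chi_eq {a b : F} (hv : ValidPair a b) : chi b = chi a := by
  have h := inR_iff.1 hv.1
  rw [chi_mul] at h
  have := chi_sq hv.ne.1
  rcases chi_ne_zero hv.ne.1 with h1 | h1 <;> rw [h1] at h ⊢ <;> linarith

theorem ValidPair.chi_eq' {a b : F} (hv : ValidPair a b) : chi (1 - b) = chi (1 - a) := by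
  have h := inR_iff.1 hv.2
  have e : (a - 1) * (b - 1) = (1 - a) * (1 - b) := by ring
  rw [e, chi_mul] at h
  rcases chi_ne_zero hv.ne.2.2.1 with h1 | h1 <;> rw [h1] at h ⊢ <;> linarith

theorem chi_ph {a b : F} (hv : ValidPair a b) (w : F) : chi (ph a b w) = chi a * chi w := by
  rcases chi_cases w with h | h | h
  · rw [chi_eq_zero] at h; simp [h, ph_zero, chi_zero]
  · rw [ph_pos h, chi_mul]
  · rw [ph_neg h, chi_mul, hv.chi_eq]

theorem chi_sub_ph {a b : F} (hv : ValidPair a b) (w : F) :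
    chi (w - ph a b w) = chi (1 - a) * chi w := by
  rcases chi_cases w with h | h | h
  · rw [chi_eq_zero] at h; simp [h, ph_zero, chi_zero]
  · rw [ph_pos h, ← chi_mul]; congr 1; ring
  · rw [ph_neg h, ← hv.chi_eq', ← chi_mul]; congr 1; ring

theorem ph_injective {a b : F} (hv : ValidPair a b) : Function.Injective (ph a b) := by
  intro x y h
  have hc : chi x = chi y := by
    have := congrArg chi h
    rw [chi_ph hv, chi_ph hv] at this
    exact mul_left_cancel₀ (mt chi_eq_zero.1 hv.ne.1) this
  rcases chi_cases x with h1 | h1 | h1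
  · rw [h1] at hc; rw [chi_eq_zero.1 h1, chi_eq_zero.1 hc.symm]
  · rw [ph_pos h1, ph_pos (hc ▸ h1)] at h
    exact mul_left_cancel₀ hv.ne.1 h
  · rw [ph_neg h1, ph_neg (hc ▸ h1)] at h
    exact mul_left_cancel₀ hv.ne.2.1 h

theorem sub_ph_injective {a b : F} (hv : ValidPair a b) :
    Function.Injective (fun w => w - ph a b w) := by
  intro x y h
  simp only at h
  have hc : chi x = chi y := by
    have := congrArg chi h
    rw [chi_sub_ph hv, chi_sub_ph hv] at this
    exact mul_left_cancel₀ (mt chi_eq_zero.1 hv.ne.2.2.1) this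
  rcases chi_cases x with h1 | h1 | h1
  · rw [h1] at hc; rw [chi_eq_zero.1 h1, chi_eq_zero.1 hc.symm]
  · rw [ph_pos h1, ph_pos (hc ▸ h1)] at h
    exact mul_left_cancel₀ hv.ne.2.2.1 (by linear_combination h)
  · rw [ph_neg h1, ph_neg (hc ▸ h1)] at h
    exact mul_left_cancel₀ hv.ne.2.2.2 (by linear_combination h)

theorem ph_mul_sq {a b r : F} (hr : chi r = 1) (w : F) : ph a b (r * w) = r * ph a b w := by
  have h : chi (r * w) = chi w := by rw [chi_mul, hr, one_mul]
  rcases chi_cases w with h1 | h1 | h1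
  · rw [chi_eq_zero] at h1; simp [h1, ph_zero]
  · rw [ph_pos h1, ph_pos (h.trans h1)]; ring
  · rw [ph_neg h1, ph_neg (h.trans h1)]; ring

theorem three_lt_card {a b : F} (hv : ValidPair a b) (hab : a ≠ b) : 3 < Fintype.card F := by
  have h1 := hv.ne
  have : ({0, 1, a, b} : Finset F).card = 4 := by
    rw [Finset.card_insert_of_notMem, Finset.card_insert_of_notMem,
      Finset.card_insert_of_notMem, Finset.card_singleton]
    · simpa using hab
    · simp only [mem_insert, mem_singleton, not_or]
      exact ⟨fun h => h1.2.2.1 (by rw [← h]; ring), fun h => h1.2.2.2 (by rw [← h]; ring)⟩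
    · simp only [mem_insert, mem_singleton, not_or]
      exact ⟨zero_ne_one, h1.1.symm, h1.2.1.symm⟩
  have h4 := Finset.card_le_univ ({0, 1, a, b} : Finset F)
  omega

/-- Existence of `z` with `χ(z) χ(c - z) = -1`, when `χ(-1) = 1`. -/
theorem exists_chi_neg (h2 : ringChar F ≠ 2) (hm : chi (-1 : F) = 1) {c : F} (hc : c ≠ 0) :
    ∃ z, chi z * chi (c - z) = -1 := by
  by_contra! h
  have h3 := sum_chi_mul_sub h2 hc
  have : 0 ≤ ∑ z : F, chi z * chi (c - z) := by
    refine Finset.sum_nonneg fun z _ => ?_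
    have := h z
    rcases chi_cases z with h1 | h1 | h1 <;> rcases chi_cases (c - z) with h4 | h4 | h4 <;>
      rw [h1, h4] at this ⊢ <;> revert this <;> norm_num
  rw [h3, hm] at this
  norm_num at this

/-- Existence of two squares summing to a nonsquare. -/
theorem exists_chi_pos (h2 : ringChar F ≠ 2) (hq : 3 < Fintype.card F) (hm : chi (-1 : F) = -1)
    {s c : F} (hc : chi s * chi c = -1) (c' : F) :
    ∃ z, chi z = chi s ∧ chi (c - z) = chi s ∧ z ≠ c' := by
  by_contra! h
  have hs0 : s ≠ 0 := by rintro rfl; simp [chi_zero] at hc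
  have hc0 : c ≠ 0 := by rintro rfl; simp [chi_zero] at hc
  have h3 := sum_chi_mul_sub h2 hc0
  have h4 : ∑ z : F, chi z = 0 := by simpa using sum_chi_shift h2 (0 : F)
  have h5 : ∑ z : F, chi (c - z) = 0 := by
    rw [← h4]; exact Equiv.sum_comp (Equiv.subLeft c) chi
  have h6 : ∑ z : F, (1 + chi s * chi z) * (1 + chi s * chi (c - z)) = Fintype.card F + 1 := by
    have : ∀ z : F, (1 + chi s * chi z) * (1 + chi s * chi (c - z)) =
        1 + chi s * chi z + chi s * chi (c - z) + chi z * chi (c - z) := by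
      intro z
      linear_combination (chi z * chi (c - z)) * chi_sq hs0
    rw [Finset.sum_congr rfl fun z _ => this z, Finset.sum_add_distrib, Finset.sum_add_distrib,
      Finset.sum_add_distrib, ← Finset.mul_sum, ← Finset.mul_sum, h3, h4, h5, hm]
    simp
  have h7 : ∑ z : F, (1 + chi s * chi z) * (1 + chi s * chi (c - z)) ≤
      ∑ z : F, (if z = c' then 4 else 0) := by
    refine Finset.sum_le_sum fun z _ => ?_
    have h8 := h z
    have h0 : chi z = 0 → chi (c - z) = chi c := by
      intro h; rw [chi_eq_zero] at h; simp [h]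
    have h0' : chi (c - z) = 0 → chi z = chi c := by
      intro h; rw [chi_eq_zero, sub_eq_zero] at h; rw [h]
    rcases chi_ne_zero hs0 with e | e <;> rw [e] at h8 hc ⊢ <;> 
    rcases chi_cases z with h1 | h1 | h1 <;> rcases chi_cases (c - z) with h4 | h4 | h4 <;>
      simp only [h1, h4] at h8 h0 h0' ⊢ <;> split_ifs <;> norm_num at h8 h0 h0' ⊢ <;>
      first | omega | (exfalso; simp_all) 
  rw [h6] at h7
  simp at h7
  have hq' : (3 : ℤ) < Fintype.card F := by exact_mod_cast hq
  linarith

theorem shift_zero (h2 : ringChar F ≠ 2) {a b : F} (hv : ValidPair a b) (hab : a ≠ b)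
    (A : F →+ F) (hA : Function.Injective A) (c e : F)
    (h : ∀ d, ph a b (A d + c) = A (ph a b d) + e) : c = 0 := by
  by_contra hc
  have hq := three_lt_card hv hab
  have h20 := two_ne h2
  have hsur : Function.Surjective A := Finite.surjective_of_injective hA
  have he : ph a b c = e := by simpa [ph_zero] using h 0
  have hc2 : 2 * c ≠ 0 := mul_ne_zero h20 hc
  have hs : ∀ d, ph a b (c + A d) + ph a b (c - A d) - 2 * ph a b c =
      A (ph a b d + ph a b (-d)) := by
    intro d
    have e1 := h d
    have e2 := h (-d)
    rw [map_neg] at e2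
    have e3 : c - A d = -A d + c := by ring
    rw [add_comm c, e3, e1, e2, he, map_add]
    ring
  rcases chi_ne_zero (F := F) (x := -1) (by simp) with hm | hm
  · have hodd : ∀ d, ph a b d + ph a b (-d) = 0 := by
      intro d
      have := ph_mul_sq (a := a) (b := b) hm d
      rw [neg_one_mul] at this
      rw [this]; ring
    obtain ⟨z, hz⟩ := exists_chi_neg h2 hm hc2
    obtain ⟨d, hd⟩ := hsur (z - c)
    have h1 := hs d
    rw [hodd, map_zero, hd] at h1
    have e1 : c + (z - c) = z := by ring
    have e2 : c - (z - c) = 2 * c - z := by ring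
    rw [e1, e2] at h1
    have hz0 : z ≠ 0 := by rintro rfl; simp [chi_zero] at hz
    have hz1 : 2 * c - z ≠ 0 := by intro h; simp [h, chi_zero] at hz
    have hab' := sub_ne_zero.2 hab
    rcases chi_ne_zero hz0 with e3 | e3
    · have e4 : chi (2 * c - z) = -1 := by rw [e3] at hz; linarith
      rw [ph_pos e3, ph_neg e4] at h1
      rcases chi_ne_zero hc with e5 | e5
      · rw [ph_pos e5] at h1
        exact mul_ne_zero hab' hz1 (by linear_combination -h1)
      · rw [ph_neg e5] at h1
        exact mul_ne_zero hab' hz0 (by linear_combination h1)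
    · have e4 : chi (2 * c - z) = 1 := by rw [e3] at hz; linarith
      rw [ph_neg e3, ph_pos e4] at h1
      rcases chi_ne_zero hc with e5 | e5
      · rw [ph_pos e5] at h1
        exact mul_ne_zero hab' hz0 (by linear_combination -h1)
      · rw [ph_neg e5] at h1
        exact mul_ne_zero hab' hz1 (by linear_combination h1)
  · have hne : ∀ d, d ≠ 0 → A (ph a b d + ph a b (-d)) ≠ 0 := by
      intro d hd h0
      rw [map_eq_zero_iff A hA] at h0
      have e0 : chi (-d) = - chi d := by rw [← neg_one_mul, chi_mul, hm]; ring
      have hab' := sub_ne_zero.2 hab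
      rcases chi_ne_zero hd with e1 | e1 <;> rw [e1] at e0
      · rw [ph_pos e1, ph_neg e0] at h0
        exact mul_ne_zero hab' hd (by linear_combination h0)
      · rw [neg_neg] at e0
        rw [ph_neg e1, ph_pos e0] at h0
        exact mul_ne_zero hab' hd (by linear_combination -h0)
    have hc3 : ∀ z, z ≠ c → ph a b z + ph a b (2 * c - z) ≠ 2 * ph a b c := by
      intro z hz h0
      obtain ⟨d, hd⟩ := hsur (z - c)
      have h1 := hs d
      rw [hd] at h1
      have e1 : c + (z - c) = z := by ring
      have e2 : c - (z - c) = 2 * c - z := by ring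
      rw [e1, e2, h0, sub_self] at h1
      refine hne d ?_ h1.symm
      rintro rfl
      rw [map_zero] at hd
      exact hz (by linear_combination -hd)
    rcases chi_ne_zero h20 with h3 | h3
    · refine hc3 0 (Ne.symm hc) ?_
      rw [ph_zero, sub_zero, ph_mul_sq h3]; ring
    · have h4 : chi c * chi (2 * c) = -1 := by
        rw [chi_mul, h3]; linear_combination - chi_sq hc
      obtain ⟨z, z1, z2, z3⟩ := exists_chi_pos h2 hq hm h4 c
      refine hc3 z z3 ?_
      rcases chi_ne_zero hc with e5 | e5
      · rw [e5] at z1 z2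
        rw [ph_pos e5, ph_pos z1, ph_pos z2]; ring
      · rw [e5] at z1 z2
        rw [ph_neg e5, ph_neg z1, ph_neg z2]; ring
set_option linter.unusedSectionVars false

/-! ### Power sums of monomials in the Galois conjugates -/

section GalSums
variable {p : ℕ} [hp : Fact p.Prime] [Algebra (ZMod p) F]

theorem gal_enum : ∃ e : Fin (Module.finrank (ZMod p) F) ≃ (F ≃ₐ[ZMod p] F),
    ∀ i x, e i x = x ^ p ^ (i : ℕ) := by
  refine ⟨Equiv.ofBijective _ (FiniteField.bijective_frobeniusAlgEquivOfAlgebraic_pow (ZMod p) F), ?_⟩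
  intro i x
  rw [Equiv.ofBijective_apply, AlgEquiv.coe_pow,
    FiniteField.coe_frobeniusAlgEquivOfAlgebraic_iterate, ZMod.card]

theorem card_gal : Fintype.card (F ≃ₐ[ZMod p] F) = Module.finrank (ZMod p) F := by
  obtain ⟨e, _⟩ := gal_enum (F := F) (p := p)
  rw [← Fintype.card_congr e, Fintype.card_fin]

theorem card_F : Fintype.card F = p ^ Module.finrank (ZMod p) F := by
  rw [Module.card_eq_pow_finrank (K := ZMod p), ZMod.card]

theorem exists_frob : ∃ f : F ≃ₐ[ZMod p] F, ∀ x, f x = x ^ p :=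
  ⟨FiniteField.frobeniusAlgEquivOfAlgebraic (ZMod p) F, fun x => by
    rw [FiniteField.coe_frobeniusAlgEquivOfAlgebraic, ZMod.card]⟩

/-- product over Galois group, as a power -/
theorem gal_prod_pow (g : (F ≃ₐ[ZMod p] F) → ℕ) (e : Fin (Module.finrank (ZMod p) F) ≃ (F ≃ₐ[ZMod p] F))
    (he : ∀ i x, e i x = x ^ p ^ (i : ℕ)) (x : F) :
    ∏ σ : F ≃ₐ[ZMod p] F, (σ x) ^ g σ = x ^ ∑ i : Fin (Module.finrank (ZMod p) F), p ^ (i : ℕ) * g (e i) := by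
  rw [← Equiv.prod_comp e, ← Finset.prod_pow_eq_pow_sum]
  refine Finset.prod_congr rfl fun i _ => ?_
  rw [he, pow_mul]

theorem geom_p (n : ℕ) : (∑ i : Fin n, p ^ (i : ℕ) * (p - 1)) = p ^ n - 1 := by
  rw [← Finset.sum_mul, Fin.sum_univ_eq_sum_range (fun i => p ^ i) n]
  have h := geom_sum_mul (R := ℤ) p n
  have h1 : 1 ≤ p := hp.out.one_le
  have h2 : 1 ≤ p ^ n := Nat.one_le_pow _ _ h1
  zify [h1, h2]
  exact_mod_cast h

theorem sum_pow_card_pred : ∑ x : F, x ^ (Fintype.card F - 1) = -1 := by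
  have h1 : ∀ x : F, x ^ (Fintype.card F - 1) = 1 - if x = 0 then 1 else 0 := by
    intro x
    split_ifs with h
    · rw [h, zero_pow (by have := Fintype.one_lt_card (α := F); omega)]; ring
    · rw [FiniteField.pow_card_sub_one_eq_one x h]; ring
  rw [Finset.sum_congr rfl fun x _ => h1 x, Finset.sum_sub_distrib]
  simp

theorem gal_sum_monomial (N : ℕ) : ∀ g : (F ≃ₐ[ZMod p] F) → ℕ, ∑ σ, g σ = N →
    (N < Module.finrank (ZMod p) F * (p - 1) → ∑ x : F, ∏ σ : F ≃ₐ[ZMod p] F, (σ x) ^ g σ = 0) ∧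
    (N = Module.finrank (ZMod p) F * (p - 1) → ∑ x : F, ∏ σ : F ≃ₐ[ZMod p] F, (σ x) ^ g σ =
      if ∀ σ, g σ = p - 1 then -1 else 0) := by
  induction N using Nat.strong_induction_on with
  | _ N ih =>
  intro g hg
  obtain ⟨e, he⟩ := gal_enum (F := F) (p := p)
  have hp1 := hp.out.two_le
  by_cases hbig : ∃ σ, p ≤ g σ
  · -- reduce
    obtain ⟨σ, hσ⟩ := hbig
    obtain ⟨f, hf⟩ := exists_frob (F := F) (p := p)
    set g1 : (F ≃ₐ[ZMod p] F) → ℕ := fun τ => g τ - (if τ = σ then p else 0) with hg1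
    set g2 : (F ≃ₐ[ZMod p] F) → ℕ := fun τ => g1 τ + (if τ = f * σ then 1 else 0) with hg2
    have hgg : ∀ τ, g τ = g1 τ + (if τ = σ then p else 0) := by
      intro τ; simp only [hg1]; split_ifs with h
      · subst h; omega
      · omega
    have hs1 : ∑ τ, g τ = ∑ τ, g1 τ + p := by
      rw [Finset.sum_congr rfl fun τ _ => hgg τ, Finset.sum_add_distrib]; simp
    have hs2 : ∑ τ, g2 τ = ∑ τ, g1 τ + 1 := by
      simp only [hg2]; rw [Finset.sum_add_distrib]; simp
    have heq : ∀ x : F, ∏ τ : F ≃ₐ[ZMod p] F, (τ x) ^ g τ = ∏ τ : F ≃ₐ[ZMod p] F, (τ x) ^ g2 τ := by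
      intro x
      rw [Finset.prod_congr rfl fun τ _ => by rw [hgg τ]]
      simp only [hg2, pow_add, Finset.prod_mul_distrib]
      congr 1
      simp only [pow_ite, pow_zero, pow_one]
      rw [Finset.prod_ite_eq' , Finset.prod_ite_eq']
      simp [hf]
    have hlt : ∑ τ, g2 τ < N := by omega
    have h0 : N ≤ Module.finrank (ZMod p) F * (p - 1) → ∑ x : F, ∏ τ : F ≃ₐ[ZMod p] F, (τ x) ^ g τ = 0 := by
      intro h
      rw [Finset.sum_congr rfl fun x _ => heq x]
      exact (ih _ hlt g2 rfl).1 (by omega)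
    refine ⟨fun h => h0 h.le, fun h => ?_⟩
    rw [h0 h.le, if_neg]
    intro h; have := h σ; omega
  · push Not at hbig
    have hle : ∀ σ, g σ ≤ p - 1 := fun σ => by have := hbig σ; omega
    have key : ∑ x : F, ∏ σ : F ≃ₐ[ZMod p] F, (σ x) ^ g σ =
      if ∀ σ, g σ = p - 1 then -1 else 0 := by
      rw [Finset.sum_congr rfl fun x _ => gal_prod_pow g e he x]
      split_ifs with h
      · have h1 : ∑ i : Fin (Module.finrank (ZMod p) F), p ^ (i : ℕ) * g (e i) = Fintype.card F - 1 := by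
          rw [card_F (p := p), ← geom_p]
          exact Finset.sum_congr rfl fun i _ => by rw [h]
        rw [h1, sum_pow_card_pred]
      · apply FiniteField.sum_pow_lt_card_sub_one
        rw [card_F (p := p), ← geom_p]
        push Not at h
        obtain ⟨σ, hσ⟩ := h
        refine Finset.sum_lt_sum (fun i _ => Nat.mul_le_mul_left _ (hle _)) ⟨e.symm σ, mem_univ _, ?_⟩
        rw [e.apply_symm_apply]
        have := hle σ
        exact Nat.mul_lt_mul_of_pos_left (by omega) (pow_pos (by omega) _)
    refine ⟨fun h => ?_, fun _ => key⟩
    rw [key, if_neg]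
    intro h'
    rw [Finset.sum_congr rfl fun σ _ => h' σ] at hg
    simp [card_gal] at hg
    omega

/-- evaluation at conjugates -/
def ev (p : ℕ) [Fact p.Prime] [Algebra (ZMod p) F] (x : F) : MvPolynomial (F ≃ₐ[ZMod p] F) F →+* F :=
  MvPolynomial.eval (fun σ => σ x)

theorem sum_ev_eq (P : MvPolynomial (F ≃ₐ[ZMod p] F) F) :
    ∑ x, ev p x P = ∑ m ∈ P.support, P.coeff m * ∑ x : F, ∏ σ : F ≃ₐ[ZMod p] F, (σ x) ^ m σ := by
  simp only [ev, MvPolynomial.eval_eq']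
  rw [Finset.sum_comm]
  simp_rw [Finset.mul_sum]

theorem sum_ev_low (P : MvPolynomial (F ≃ₐ[ZMod p] F) F)
    (hP : P.totalDegree < Module.finrank (ZMod p) F * (p - 1)) : ∑ x, ev p x P = 0 := by
  rw [sum_ev_eq]
  refine Finset.sum_eq_zero fun m hm => ?_
  have h1 := MvPolynomial.le_totalDegree hm
  rw [Finsupp.sum_fintype _ _ (fun _ => rfl)] at h1
  rw [(gal_sum_monomial _ m rfl).1 (lt_of_le_of_lt h1 hP), mul_zero]

theorem sum_ev_hom (P : MvPolynomial (F ≃ₐ[ZMod p] F) F)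
    (hP : P.IsHomogeneous (Module.finrank (ZMod p) F * (p - 1))) (t : (F ≃ₐ[ZMod p] F) →₀ ℕ)
    (ht : ∀ σ, t σ = p - 1) : ∑ x, ev p x P = - P.coeff t := by
  rw [sum_ev_eq]
  have : ∀ m ∈ P.support, P.coeff m * ∑ x : F, ∏ σ : F ≃ₐ[ZMod p] F, (σ x) ^ m σ =
      if m = t then - P.coeff t else 0 := by
    intro m hm
    have h1 : Finsupp.degree m = Module.finrank (ZMod p) F * (p - 1) := by
      by_contra h
      exact (MvPolynomial.mem_support_iff.1 hm) (hP.coeff_eq_zero h)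
    rw [Finsupp.degree_eq_sum] at h1
    rw [(gal_sum_monomial _ m rfl).2 h1]
    by_cases hmt : m = t
    · subst hmt; rw [if_pos ht, if_pos rfl]; ring
    · rw [if_neg, if_neg hmt, mul_zero]
      intro h; apply hmt; ext σ; rw [h, ht]
  rw [Finset.sum_congr rfl this, Finset.sum_ite_eq']
  split_ifs with h
  · rfl
  · rw [MvPolynomial.notMem_support_iff.1 h, neg_zero]

theorem chi_eq_prod (h2 : ringChar F ≠ 2) (hpo : p ≠ 2) (y : F) :
    ((chi y : ℤ) : F) = ∏ τ : F ≃ₐ[ZMod p] F, (τ y) ^ ((p - 1) / 2) := by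
  obtain ⟨e, he⟩ := gal_enum (F := F) (p := p)
  rw [gal_prod_pow _ e he]
  unfold chi
  rw [quadraticChar_eq_pow_of_char_ne_two' h2]
  congr 1
  have h1 := geom_p (p := p) (Module.finrank (ZMod p) F)
  rw [← card_F, ← Finset.sum_mul] at h1
  rw [← Finset.sum_mul]
  have h3 : p % 2 = 1 := hp.out.eq_two_or_odd.resolve_left hpo
  obtain ⟨h, hh⟩ : ∃ h, p - 1 = 2 * h := ⟨(p-1)/2, by omega⟩
  rw [hh] at h1 ⊢
  have h4 := FiniteField.odd_card_of_char_ne_two h2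
  rw [Nat.mul_div_cancel_left _ (by norm_num)]
  have : (∑ i : Fin (Module.finrank (ZMod p) F), p ^ (i : ℕ)) * (2 * h) = 2 * ((∑ i : Fin (Module.finrank (ZMod p) F), p ^ (i : ℕ)) * h) := by ring
  omega

/-- linear form -/
def lin (c : (F ≃ₐ[ZMod p] F) → F) : MvPolynomial (F ≃ₐ[ZMod p] F) F :=
  ∑ σ, MvPolynomial.C (c σ) * MvPolynomial.X σ

theorem ev_lin (c : (F ≃ₐ[ZMod p] F) → F) (x : F) : ev p x (lin c) = ∑ σ, c σ * σ x := by
  simp [ev, lin]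

theorem lin_hom (c : (F ≃ₐ[ZMod p] F) → F) : (lin c).IsHomogeneous 1 :=
  MvPolynomial.IsHomogeneous.sum _ _ _ fun σ _ => by
    simpa using (MvPolynomial.isHomogeneous_C _ (c σ)).mul (MvPolynomial.isHomogeneous_X _ σ)

theorem lin_deg (c : (F ≃ₐ[ZMod p] F) → F) : (lin c).totalDegree ≤ 1 := (lin_hom c).totalDegree_le

theorem exists_lin (A : F →+ F) : ∃ c : (F ≃ₐ[ZMod p] F) → F, ∀ x, A x = ∑ σ, c σ * σ x := by
  let A' : F →ₗ[ZMod p] F := A.toZModLinearMap p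
  let b : (F ≃ₐ[ZMod p] F) → (F →ₗ[ZMod p] F) := fun σ => (σ : F →ₐ[ZMod p] F).toLinearMap
  have hb : LinearIndependent F b := by
    refine (linearIndependent_toLinearMap (ZMod p) F F).comp
      (fun σ : F ≃ₐ[ZMod p] F => (σ : F →ₐ[ZMod p] F)) ?_
    intro σ τ h
    ext x
    exact congrArg (fun f : F →ₐ[ZMod p] F => f x) h
  have hs := hb.span_eq_top_of_card_eq_finrank (by
    rw [card_gal, Module.finrank_linearMap_self])
  have hA : A' ∈ Submodule.span F (Set.range b) := by rw [hs]; trivial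
  rw [Submodule.mem_span_range_iff_exists_fun] at hA
  obtain ⟨c, hc⟩ := hA
  refine ⟨c, fun x => ?_⟩
  have := congrArg (fun f : F →ₗ[ZMod p] F => f x) hc
  simp [b, LinearMap.sum_apply] at this
  exact this.symm

end GalSums
set_option linter.unusedSectionVars false

/-! ### Additive maps commuting with `φ` are monomial -/

section Monomial
variable {p : ℕ} [hp : Fact p.Prime] [Algebra (ZMod p) F]

theorem coeff_lin_mul (c : (F ≃ₐ[ZMod p] F) → F) (Q : MvPolynomial (F ≃ₐ[ZMod p] F) F)
    (t : (F ≃ₐ[ZMod p] F) →₀ ℕ) : (lin c * Q).coeff t =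
      ∑ σ, if t σ ≠ 0 then c σ * Q.coeff (t - Finsupp.single σ 1) else 0 := by
  unfold lin
  rw [Finset.sum_mul, MvPolynomial.coeff_sum]
  refine Finset.sum_congr rfl fun σ _ => ?_
  rw [mul_assoc, MvPolynomial.coeff_C_mul, MvPolynomial.coeff_X_mul']
  by_cases h : t σ ≠ 0
  · rw [if_pos (Finsupp.mem_support_iff.2 h), if_pos h]
  · rw [if_neg (fun h' => h (Finsupp.mem_support_iff.1 h')), if_neg h, mul_zero]

theorem coeff_single_pow (c : (F ≃ₐ[ZMod p] F) → F) (k : F ≃ₐ[ZMod p] F) (n : ℕ) :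
    (lin c ^ n).coeff (Finsupp.single k n) = c k ^ n := by
  induction n with
  | zero => simp
  | succ n ih =>
    rw [pow_succ', coeff_lin_mul, Finset.sum_eq_single k]
    · rw [if_pos (by simp)]
      have : Finsupp.single k (n + 1) - Finsupp.single k 1 = Finsupp.single k n := by
        rw [← Finsupp.single_tsub]; simp
      rw [this, ih, pow_succ']
    · intro σ _ h
      rw [if_neg]; simp [Finsupp.single_apply, h.symm]
    · simp

theorem coeff_two (c : (F ≃ₐ[ZMod p] F) → F) (Q : MvPolynomial (F ≃ₐ[ZMod p] F) F)
    {i k : F ≃ₐ[ZMod p] F} (hik : i ≠ k) (n : ℕ) :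
    (lin c * Q).coeff (Finsupp.single i 1 + Finsupp.single k (n + 1)) =
      c i * Q.coeff (Finsupp.single k (n + 1)) +
      c k * Q.coeff (Finsupp.single i 1 + Finsupp.single k n) := by
  rw [coeff_lin_mul, ← Finset.sum_subset (Finset.subset_univ {i, k}), Finset.sum_pair hik]
  · rw [if_pos (by simp), if_pos (by simp)]
    have e1 : Finsupp.single i 1 + Finsupp.single k (n + 1) - Finsupp.single i 1 =
        Finsupp.single k (n + 1) := by rw [add_tsub_cancel_left]
    have e2 : Finsupp.single i 1 + Finsupp.single k (n + 1) - Finsupp.single k 1 =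
        Finsupp.single i 1 + Finsupp.single k n := by
      rw [Finsupp.single_add, ← add_assoc, add_tsub_cancel_right]
    rw [e1, e2]
  · intro σ _ h
    simp only [mem_insert, mem_singleton, not_or] at h
    rw [if_neg]
    simp [Finsupp.single_apply, Ne.symm h.1, Ne.symm h.2]

theorem coeff_two_pow (c : (F ≃ₐ[ZMod p] F) → F)
    {i k : F ≃ₐ[ZMod p] F} (hik : i ≠ k) (n : ℕ) :
    (lin c ^ (n + 1)).coeff (Finsupp.single i 1 + Finsupp.single k n) = (n + 1) * c i * c k ^ n := by
  induction n with
  | zero => simpa using coeff_single_pow c i 1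
  | succ n ih =>
    rw [pow_succ', coeff_two _ _ hik, ih, coeff_single_pow]
    push_cast; ring

theorem coeff_three (c : (F ≃ₐ[ZMod p] F) → F) (Q : MvPolynomial (F ≃ₐ[ZMod p] F) F)
    {i j l : F ≃ₐ[ZMod p] F} (hij : i ≠ j) (hil : i ≠ l) (hjl : j ≠ l) :
    (lin c * Q).coeff (Finsupp.single i 1 + Finsupp.single j 1 + Finsupp.single l 1) =
      c i * Q.coeff (Finsupp.single j 1 + Finsupp.single l 1) +
      (c j * Q.coeff (Finsupp.single i 1 + Finsupp.single l 1) +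
      c l * Q.coeff (Finsupp.single i 1 + Finsupp.single j 1)) := by
  rw [coeff_lin_mul, ← Finset.sum_subset (Finset.subset_univ {i, j, l}),
    Finset.sum_insert (by simp [hij, hil]), Finset.sum_pair hjl]
  · rw [if_pos (by simp), if_pos (by simp), if_pos (by simp)]
    have e1 : Finsupp.single i 1 + Finsupp.single j 1 + Finsupp.single l 1 - Finsupp.single i 1 =
        Finsupp.single j 1 + Finsupp.single l 1 := by rw [add_assoc, add_tsub_cancel_left]
    have e2 : Finsupp.single i 1 + Finsupp.single j 1 + Finsupp.single l 1 - Finsupp.single j 1 =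
        Finsupp.single i 1 + Finsupp.single l 1 := by rw [add_right_comm, add_tsub_cancel_right]
    have e3 : Finsupp.single i 1 + Finsupp.single j 1 + Finsupp.single l 1 - Finsupp.single l 1 =
        Finsupp.single i 1 + Finsupp.single j 1 := by rw [add_tsub_cancel_right]
    rw [e1, e2, e3]
  · intro σ _ h
    simp only [mem_insert, mem_singleton, not_or] at h
    rw [if_neg]
    simp [Finsupp.single_apply, Ne.symm h.1, Ne.symm h.2.1, Ne.symm h.2.2]

theorem map_chi (A : F →+ F) (x y : F) : A (x * (chi y : F)) = A x * (chi y : F) := by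
  rcases chi_cases y with h | h | h <;> rw [h] <;> simp

theorem comm_ident (h2 : ringChar F ≠ 2) {a b : F} (A : F →+ F)
    (hA : ∀ x, A (ph a b x) = ph a b (A x)) (x : F) :
    (a - b) * (A x * (chi (A x) : F)) =
      A ((a - b) * x) * (chi x : F) + (A ((a + b) * x) - (a + b) * A x) := by
  have h1 : A (2 * ph a b x) = 2 * ph a b (A x) := by
    rw [two_mul, map_add, hA]; ring
  rw [ph_two, ph_two, map_add, ← mul_assoc (a - b) x, map_chi] at h1
  linear_combination -h1

/-- conjugate of a linear form -/
def conj (c : (F ≃ₐ[ZMod p] F) → F) (τ : F ≃ₐ[ZMod p] F) : (F ≃ₐ[ZMod p] F) → F :=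
  fun σ => τ (c (τ⁻¹ * σ))

theorem ev_conj (c : (F ≃ₐ[ZMod p] F) → F) (τ : F ≃ₐ[ZMod p] F) (x : F) :
    ev p x (lin (conj c τ)) = τ (∑ σ, c σ * σ x) := by
  rw [ev_lin, map_sum, ← Equiv.sum_comp (Equiv.mulLeft τ)]
  refine Finset.sum_congr rfl fun σ _ => ?_
  simp [conj]

theorem coeff_test (h2 : ringChar F ≠ 2) (hpo : p ≠ 2) {a b : F} (A : F →+ F)
    (hA : ∀ x, A (ph a b x) = ph a b (A x)) (c : (F ≃ₐ[ZMod p] F) → F)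
    (hc : ∀ x, A x = ∑ σ, c σ * σ x) (t : (F ≃ₐ[ZMod p] F) →₀ ℕ)
    (ht : ∀ σ, t σ ≤ (p - 1) / 2) (n : ℕ) (hn : ∑ σ, t σ = n + 1)
    (Q : MvPolynomial (F ≃ₐ[ZMod p] F) F) (hQ : Q.IsHomogeneous n)
    (G : MvPolynomial (F ≃ₐ[ZMod p] F) F)
    (hG : G.totalDegree ≤ Module.finrank (ZMod p) F * ((p - 1) / 2) + n)
    (hGe : ∀ x, A x * (chi (A x) : F) * ev p x Q = ev p x G) :
    (lin (fun σ => c σ * σ (a - b)) * Q).coeff t = 0 := by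
  have h3 : p % 2 = 1 := hp.out.eq_two_or_odd.resolve_left hpo
  obtain ⟨h, hh⟩ : ∃ h, p - 1 = 2 * h := ⟨(p-1)/2, by omega⟩
  have hh2 : (p - 1) / 2 = h := by omega
  have hprod := chi_eq_prod (p := p) h2 hpo
  rw [hh2] at ht hG hprod
  set d := Module.finrank (ZMod p) F with hd
  have hcard : Fintype.card (F ≃ₐ[ZMod p] F) = d := card_gal
  let H : (F ≃ₐ[ZMod p] F) →₀ ℕ := Finsupp.equivFunOnFinite.symm fun _ => h
  let s : (F ≃ₐ[ZMod p] F) →₀ ℕ := Finsupp.equivFunOnFinite.symm fun σ => h - t σ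
  have hts : t + s = H := by
    ext σ
    simp only [s, H, Finsupp.add_apply, Finsupp.equivFunOnFinite_symm_apply_apply]
    have := ht σ; omega
  have hHd : Finsupp.degree H = d * h := by
    rw [Finsupp.degree_eq_sum]; simp [H, hcard]
  have htd : Finsupp.degree t = n + 1 := by rw [Finsupp.degree_eq_sum, hn]
  have hsd : (n + 1) + Finsupp.degree s = d * h := by
    rw [← htd, ← hHd, ← hts, map_add]
  have hD : d * (p - 1) = d * h + d * h := by rw [hh]; ring
  have hevs : ∀ x, ev p x (MvPolynomial.monomial H 1) = (chi x : F) := by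
    intro x
    rw [hprod, ev, MvPolynomial.eval_monomial, one_mul, Finsupp.prod_fintype _ _ (by simp)]
    rfl
  let P1 := lin (fun σ => c σ * σ (a - b)) * Q * MvPolynomial.monomial (s + H) 1
  let P2 := lin (fun σ => c σ * σ (a + b) - (a + b) * c σ) * Q * MvPolynomial.monomial s 1
  let P3 := MvPolynomial.C (a - b) * G * MvPolynomial.monomial s 1
  have hmon : MvPolynomial.monomial (s + H) (1 : F) =
      MvPolynomial.monomial s 1 * MvPolynomial.monomial H 1 := by
    rw [MvPolynomial.monomial_mul, one_mul]
  have hev : ∀ x, ev p x P3 = ev p x P1 + ev p x P2 := by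
    intro x
    simp only [P1, P2, P3, hmon, map_mul, ev_lin, hevs, ← hGe]
    have e1 : ∑ σ : F ≃ₐ[ZMod p] F, c σ * σ (a - b) * σ x = A ((a - b) * x) := by
      rw [hc]; exact Finset.sum_congr rfl fun σ _ => by rw [map_mul]; ring
    have e2 : ∑ σ : F ≃ₐ[ZMod p] F, (c σ * σ (a + b) - (a + b) * c σ) * σ x =
        A ((a + b) * x) - (a + b) * A x := by
      rw [hc, hc, Finset.mul_sum, ← Finset.sum_sub_distrib]
      exact Finset.sum_congr rfl fun σ _ => by rw [map_mul]; ring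
    have e3 : ev p x (MvPolynomial.C (a - b)) = a - b := by simp [ev]
    rw [e1, e2, e3]
    linear_combination (ev p x Q * ev p x (MvPolynomial.monomial s 1)) * comm_ident h2 A hA x
  have hsm : (MvPolynomial.monomial s (1 : F)).totalDegree ≤ Finsupp.degree s :=
    (MvPolynomial.isHomogeneous_monomial (1 : F) rfl).totalDegree_le
  have hP3 : ∑ x, ev p x P3 = 0 := by
    apply sum_ev_low
    refine lt_of_le_of_lt (MvPolynomial.totalDegree_mul _ _) ?_
    have := MvPolynomial.totalDegree_mul (MvPolynomial.C (a - b)) G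
    rw [MvPolynomial.totalDegree_C] at this
    rw [← hd, hD]
    omega
  have hP2 : ∑ x, ev p x P2 = 0 := by
    apply sum_ev_low
    refine lt_of_le_of_lt (MvPolynomial.totalDegree_mul _ _) ?_
    have := MvPolynomial.totalDegree_mul (lin (fun σ => c σ * σ (a + b) - (a + b) * c σ)) Q
    have h4 := lin_deg (fun σ : F ≃ₐ[ZMod p] F => c σ * σ (a + b) - (a + b) * c σ)
    have h5 := hQ.totalDegree_le
    rw [← hd, hD]
    omega
  have hP1 : ∑ x, ev p x P1 = - P1.coeff (t + (s + H)) := by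
    apply sum_ev_hom
    · have := ((lin_hom (fun σ : F ≃ₐ[ZMod p] F => c σ * σ (a - b))).mul hQ).mul
        (MvPolynomial.isHomogeneous_monomial (d := s + H) (1 : F) rfl)
      have e : Module.finrank (ZMod p) F * (p - 1) = 1 + n + Finsupp.degree (s + H) := by
        rw [← hd, hD, map_add, hHd]; omega
      rw [e]; exact this
    · intro σ
      rw [← add_assoc, hts, hh]
      simp [H]; ring
  have hfin := Finset.sum_congr rfl fun x (_ : x ∈ (univ : Finset F)) => hev x
  rw [Finset.sum_add_distrib, hP1, hP2, hP3] at hfin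
  have : P1.coeff (t + (s + H)) = _ := MvPolynomial.coeff_mul_monomial t (s + H) (1 : F) _
  rw [this] at hfin
  linear_combination hfin

theorem prod_conj_deg (c : (F ≃ₐ[ZMod p] F) → F) (h : ℕ) (τ : F ≃ₐ[ZMod p] F) :
    (∏ σ ∈ univ.erase τ, lin (conj c σ) ^ h).totalDegree + h ≤ Module.finrank (ZMod p) F * h := by
  have h1 := MvPolynomial.totalDegree_finsetProd (univ.erase τ) fun σ => lin (conj c σ) ^ h
  have h2 : ∑ σ ∈ univ.erase τ, (lin (conj c σ) ^ h).totalDegree ≤ ∑ σ ∈ univ.erase τ, h := by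
    refine Finset.sum_le_sum fun σ _ => ?_
    refine (MvPolynomial.totalDegree_pow _ _).trans ?_
    have := lin_deg (conj c σ)
    nlinarith
  rw [Finset.sum_const, Finset.card_erase_of_mem (mem_univ _), Finset.card_univ, card_gal,
    smul_eq_mul] at h2
  have h3 : 0 < Module.finrank (ZMod p) F := Module.finrank_pos
  obtain ⟨m, hm⟩ : ∃ m, Module.finrank (ZMod p) F = m + 1 := ⟨_, (Nat.succ_pred_eq_of_pos h3).symm⟩
  rw [hm] at h2 ⊢
  rw [Nat.add_sub_cancel] at h2
  have : (m + 1) * h = m * h + h := by ring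
  omega

theorem test_one (h2 : ringChar F ≠ 2) (hpo : p ≠ 2) {a b : F} (A : F →+ F)
    (hA : ∀ x, A (ph a b x) = ph a b (A x)) (c : (F ≃ₐ[ZMod p] F) → F)
    (hc : ∀ x, A x = ∑ σ, c σ * σ x) {i k : F ≃ₐ[ZMod p] F} (hik : i ≠ k)
    (hi : c i ≠ 0) (hk : c k ≠ 0) :
    2 * i (a - b) = k (a - b) := by
  have h3 : p % 2 = 1 := hp.out.eq_two_or_odd.resolve_left hpo
  have hp2 := hp.out.two_le
  obtain ⟨n, hn⟩ : ∃ n, p = 2 * (n + 1) + 1 := ⟨(p-3)/2, by omega⟩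
  have hh : (p - 1) / 2 = n + 1 := by omega
  obtain ⟨f, hf⟩ := exists_frob (F := F) (p := p)
  have key := coeff_test h2 hpo A hA c hc (Finsupp.single i 1 + Finsupp.single k (n + 1))
    (by
      intro σ
      rw [hh]
      simp only [Finsupp.add_apply, Finsupp.single_apply]
      split_ifs with h4 h5
      · exact absurd (h4.trans h5.symm) hik
      all_goals omega) (n + 1)
    (by
      simp only [Finsupp.add_apply, Finset.sum_add_distrib, Finsupp.single_apply]
      simp; ring)
    (lin c ^ (n + 1)) (by simpa using (lin_hom c).pow (n + 1))
    (lin (conj c f) * ∏ σ ∈ univ.erase 1, lin (conj c σ) ^ (n + 1))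
    (by
      rw [hh]
      have := prod_conj_deg c (n + 1) 1
      have h5 := MvPolynomial.totalDegree_mul (lin (conj c f)) (∏ σ ∈ univ.erase 1, lin (conj c σ) ^ (n + 1))
      have h6 := lin_deg (conj c f)
      omega)
    (by
      intro x
      rw [chi_eq_prod (p := p) h2 hpo, hh]
      simp only [map_mul, map_prod, map_pow, ev_conj]
      simp only [ev_lin, ← hc]
      rw [← Finset.mul_prod_erase univ _ (mem_univ (1 : F ≃ₐ[ZMod p] F)), hf]
      have : A x ^ p = A x * A x ^ (n + 1) * A x ^ (n + 1) := by
        rw [← pow_succ', ← pow_add]; congr 1; omega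
      rw [this, AlgEquiv.one_apply]; ring)
  rw [coeff_two _ _ hik, coeff_single_pow, coeff_two_pow _ hik] at key
  have hpF : ((p : ℕ) : F) = 0 := by
    have : CharP F p := charP_of_injective_algebraMap (algebraMap (ZMod p) F).injective p
    exact CharP.cast_eq_zero F p
  have hn2 : (2 : F) * (n + 1) = -1 := by
    rw [hn] at hpF; push_cast at hpF; linear_combination hpF
  have h0 : c i * c k ^ (n + 1) * (2 * i (a - b) - k (a - b)) = 0 := by
    rw [pow_succ] at key ⊢
    linear_combination 2 * key - (c k * k (a - b) * c i * c k ^ n) * hn2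
  rcases mul_eq_zero.1 h0 with h | h
  · exact absurd h (mul_ne_zero hi (pow_ne_zero _ hk))
  · exact sub_eq_zero.1 h

theorem test_two (h2 : ringChar F ≠ 2) (hp3 : p = 3) {a b : F} (hab : a ≠ b) (A : F →+ F)
    (hA : ∀ x, A (ph a b x) = ph a b (A x)) (c : (F ≃ₐ[ZMod p] F) → F)
    (hc : ∀ x, A x = ∑ σ, c σ * σ x) {i k : F ≃ₐ[ZMod p] F} (hik : i ≠ k)
    (hi : c i ≠ 0) (hk : c k ≠ 0) (hsupp : ∀ j, c j ≠ 0 → j = i ∨ j = k)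
    (τ : F ≃ₐ[ZMod p] F) (hτ : τ ≠ 1) : i = τ * k := by
  by_contra hne
  have hpo : p ≠ 2 := by omega
  have hh : (p - 1) / 2 = 1 := by omega
  obtain ⟨f, hf⟩ := exists_frob (F := F) (p := p)
  have hij : i ≠ τ * i := fun h => hτ (by simpa using h)
  have hjl : τ * i ≠ τ * k := fun h => hik (by simpa using h)
  have key := coeff_test h2 hpo A hA c hc
    (Finsupp.single i 1 + Finsupp.single (τ * i) 1 + Finsupp.single (τ * k) 1)
    (by
      intro σ
      rw [hh]
      simp only [Finsupp.add_apply, Finsupp.single_apply]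
      split_ifs with h4 h5 h6 h7 h8 h9
      · exact absurd (h4.trans h5.symm) hij
      · exact absurd (h4.trans h5.symm) hij
      · exact absurd (h4.trans h7.symm) hne
      · omega
      · exact absurd (h8.trans h9.symm) hjl
      all_goals omega) 2
    (by
      simp only [Finsupp.add_apply, Finset.sum_add_distrib, Finsupp.single_apply]
      simp)
    (lin (conj c τ) ^ 2) (by simpa using (lin_hom (conj c τ)).pow 2)
    (lin c * lin (conj c (f * τ)) * ∏ σ ∈ univ.erase τ, lin (conj c σ) ^ 1)
    (by
      rw [hh]
      have := prod_conj_deg c 1 τ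
      have h5 := MvPolynomial.totalDegree_mul (lin c * lin (conj c (f * τ))) (∏ σ ∈ univ.erase τ, lin (conj c σ) ^ 1)
      have h6 := MvPolynomial.totalDegree_mul (lin c) (lin (conj c (f * τ)))
      have h7 := lin_deg (conj c (f * τ))
      have h8 := lin_deg c
      omega)
    (by
      intro x
      rw [chi_eq_prod (p := p) h2 hpo, hh]
      simp only [map_mul, map_prod, map_pow, ev_conj]
      simp only [ev_lin, ← hc]
      rw [← Finset.mul_prod_erase univ _ (mem_univ τ), AlgEquiv.mul_apply, hf]
      have hpow : ∀ y : F, y ^ p = y ^ 3 := fun y => by rw [hp3]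
      rw [hpow]
      ring)
  have hci : conj c τ i = 0 := by
    unfold conj
    by_contra h
    rw [map_eq_zero_iff τ τ.injective] at h
    rcases hsupp _ h with h | h
    · exact hτ (by simpa [inv_mul_eq_iff_eq_mul] using h)
    · exact hne (by rw [← h]; simp)
  have c2 : ∀ {i k : F ≃ₐ[ZMod p] F} (_ : i ≠ k), (lin (conj c τ) ^ 2).coeff
      (Finsupp.single i 1 + Finsupp.single k 1) = 2 * conj c τ i * conj c τ k := by
    intro i k hik
    have := coeff_two_pow (conj c τ) hik 1
    rw [this]; push_cast; ring
  rw [coeff_three _ _ hij hne hjl, c2 hjl, c2 hne, c2 hij, hci] at key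
  have hj : conj c τ (τ * i) = τ (c i) := by simp [conj]
  have hl : conj c τ (τ * k) = τ (c k) := by simp [conj]
  rw [hj, hl] at key
  have hτi : τ (c i) ≠ 0 := by rwa [Ne, map_eq_zero_iff τ τ.injective]
  have hτk : τ (c k) ≠ 0 := by rwa [Ne, map_eq_zero_iff τ τ.injective]
  have hiv : i (a - b) ≠ 0 := by
    rw [Ne, map_eq_zero_iff i i.injective]; exact sub_ne_zero.2 hab
  refine mul_ne_zero (mul_ne_zero hi hiv) (mul_ne_zero (mul_ne_zero (two_ne h2) hτi) hτk) ?_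
  linear_combination key

/-- Monomial lemma. -/
theorem monomial_lemma (h2 : ringChar F ≠ 2) (hpo : p ≠ 2) {a b : F} (hab : a ≠ b) (A : F →+ F)
    (hinj : Function.Injective A)
    (hA : ∀ x, A (ph a b x) = ph a b (A x)) :
    (∃ (e : F) (σ : F ≃ₐ[ZMod p] F), ∀ x, A x = e * σ x) ∨
      (p = 3 ∧ Module.finrank (ZMod p) F = 2 ∧ (a - b) ^ 3 = -(a - b)) := by
  obtain ⟨c, hc⟩ := exists_lin (p := p) A
  have hpF : ((p : ℕ) : F) = 0 := by
    have : CharP F p := charP_of_injective_algebraMap (algebraMap (ZMod p) F).injective p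
    exact CharP.cast_eq_zero F p
  have hex : ∃ i, c i ≠ 0 := by
    by_contra! h
    have h1 : A 1 = A 0 := by rw [hc, hc]; simp [h]
    exact one_ne_zero (hinj h1)
  obtain ⟨i, hi⟩ := hex
  by_cases hone : ∀ j, j ≠ i → c j = 0
  · left
    refine ⟨c i, i, fun x => ?_⟩
    rw [hc, Finset.sum_eq_single i]
    · intro j _ hj; rw [hone j hj, zero_mul]
    · simp
  right
  push Not at hone
  obtain ⟨k, hki, hk⟩ := hone
  have t1 := test_one h2 hpo A hA c hc hki.symm hi hk
  have t2 := test_one h2 hpo A hA c hc hki hk hi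
  have hv : a - b ≠ 0 := sub_ne_zero.2 hab
  have hiv : i (a - b) ≠ 0 := by rwa [Ne, map_eq_zero_iff i i.injective]
  have h30 : (3 : F) = 0 := by
    have : (3 : F) * i (a - b) = 0 := by linear_combination 2 * t1 + t2
    exact (mul_eq_zero.1 this).resolve_right hiv
  have hp3 : p = 3 := by
    have : CharP F p := charP_of_injective_algebraMap (algebraMap (ZMod p) F).injective p
    have h3 : ((3 : ℕ) : F) = 0 := by exact_mod_cast h30
    rw [CharP.cast_eq_zero_iff F p] at h3
    exact (Nat.prime_dvd_prime_iff_eq hp.out Nat.prime_three).1 h3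
  have hsupp : ∀ j, c j ≠ 0 → j = i ∨ j = k := by
    intro j hj
    by_contra! h
    have t3 := test_one h2 hpo A hA c hc h.1 hj hi
    have t4 := test_one h2 hpo A hA c hc h.2 hj hk
    apply hiv
    linear_combination t1 + t3 - t4
  have t5 := test_two h2 hp3 hab A hA c hc hki.symm hi hk hsupp
  have hcard : ∀ τ : F ≃ₐ[ZMod p] F, τ = 1 ∨ τ = i * k⁻¹ := by
    intro τ
    by_cases h : τ = 1
    · exact Or.inl h
    · right; rw [t5 τ h]; simp
  have hik1 : i * k⁻¹ ≠ 1 := fun h => hki (mul_inv_eq_one.1 h).symm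
  have hd : Module.finrank (ZMod p) F = 2 := by
    rw [← card_gal, ← Finset.card_univ]
    have : (univ : Finset (F ≃ₐ[ZMod p] F)) = {1, i * k⁻¹} := by
      ext τ; simpa using hcard τ
    rw [this, Finset.card_pair hik1.symm]
  refine ⟨hp3, hd, ?_⟩
  obtain ⟨f, hf⟩ := exists_frob (F := F) (p := p)
  have hf1 : f ≠ 1 := by
    intro h
    have hcF := card_F (F := F) (p := p)
    rw [hd] at hcF
    have hall : ∀ x : F, x ^ p - x = 0 := by
      intro x; rw [← hf x, h]; simp
    have := FiniteField.X_pow_card_sub_X_natDegree_eq F hp.out.one_lt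
    have hroot : (univ : Finset F).card ≤ (Polynomial.X ^ p - Polynomial.X : Polynomial F).natDegree := by
      apply Polynomial.card_le_degree_of_subset_roots
      intro x _
      rw [Polynomial.mem_roots (FiniteField.X_pow_card_sub_X_ne_zero F hp.out.one_lt)]
      simp [hall x]
    rw [this, Finset.card_univ, hcF, hp3] at hroot
    omega
  have hfe := (hcard f).resolve_left hf1
  have hik2 : i = f * k := by rw [hfe]; simp
  have t6 : k (2 * f (a - b) - (a - b)) = 0 := by
    have hcomm : f (k (a - b)) = k (f (a - b)) := by rw [hf, hf, map_pow]
    rw [hik2, AlgEquiv.mul_apply, hcomm] at t1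
    rw [map_sub, map_mul, map_ofNat]
    linear_combination t1
  rw [map_eq_zero_iff k k.injective, hf] at t6
  have hpow : (a - b) ^ p = (a - b) ^ 3 := by rw [hp3]
  rw [hpow] at t6
  linear_combination (a - b) ^ 3 * h30 - t6

end Monomial
set_option linter.unusedSectionVars false

/-! ### The exceptional field of order nine -/

section Nine

/-- The multiplication of the concrete model of the field with nine elements. -/
def mulM (m n : ZMod 3 × ZMod 3) : ZMod 3 × ZMod 3 :=
  (m.1 * n.1 - m.2 * n.2, m.1 * n.2 + m.2 * n.1)

/-- Nonzero squares of the model. -/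
def isR (m : ZMod 3 × ZMod 3) : Bool :=
  (m.1 == 0 && m.2 != 0) || (m.1 != 0 && m.2 == 0)

/-- Quasigroup operation of the model. -/
def qm (a b x y : ZMod 3 × ZMod 3) : ZMod 3 × ZMod 3 :=
  bif isR (y - x) then x + mulM a (y - x) else x + mulM b (y - x)

theorem isR_spec : ∀ m, isR m = true ↔ m ≠ 0 ∧ ∃ n, mulM n n = m := by decide +kernel

theorem model_norm : ∀ m : ZMod 3 × ZMod 3, m.1 * m.1 + m.2 * m.2 = 0 → m = 0 := by decide

theorem model_diag : ∀ a b, isR (mulM a b) = true → isR (mulM (a - (1, 0)) (b - (1, 0))) = true →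
    a ≠ b → (∀ x y, qm a b 0 y = qm a b x 0 → qm a b x y = qm a b 0 0) ∧
    (∃ x y, qm a b 0 y = qm a b x (1, 0) ∧ qm a b x y ≠ qm a b 0 (1, 0)) := by decide +kernel

/-- An intercalate property of a cell. -/
def Icl (a b x y : F) : Prop :=
  ∀ x2 y2, qmul a b x y2 = qmul a b x2 y → qmul a b x2 y2 = qmul a b x y

theorem nine_exception [Algebra (ZMod 3) F] (hcard : Fintype.card F = 9) {v : F} (hv2 : v * v = -1)
    {a b : F} (hv : ValidPair a b) (hab : a ≠ b) : Icl a b 0 0 ∧ ¬ Icl a b 0 1 := by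
  have : Fact (Nat.Prime 3) := ⟨Nat.prime_three⟩
  let f := algebraMap (ZMod 3) F
  let g : ZMod 3 × ZMod 3 → F := fun m => f m.1 + f m.2 * v
  have gmul : ∀ m n, g (mulM m n) = g m * g n := by
    intro m n
    simp only [g, mulM, map_sub, map_add, map_mul]
    linear_combination -(f m.2 * f n.2) * hv2
  have gadd : ∀ m n, g (m + n) = g m + g n := by
    intro m n
    simp only [g, Prod.fst_add, Prod.snd_add, map_add]; ring
  have gsub : ∀ m n, g (m - n) = g m - g n := by
    intro m n
    simp only [g, Prod.fst_sub, Prod.snd_sub, map_sub]; ring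
  have g0 : g 0 = 0 := by simp [g]
  have g1 : g (1, 0) = 1 := by simp [g]
  have gz : ∀ m, g m = 0 → m = 0 := by
    intro m hm
    have h1 : g (mulM m (m.1, -m.2)) = 0 := by rw [gmul, hm, zero_mul]
    have h2 : f (m.1 * m.1 + m.2 * m.2) = 0 := by
      rw [← h1]; simp only [g, mulM, map_sub, map_add, map_mul, map_neg]; ring
    have h3 : m.1 * m.1 + m.2 * m.2 = 0 := (map_eq_zero f).1 h2
    exact model_norm m h3
  have ginj : Function.Injective g := by
    intro m n h
    exact sub_eq_zero.1 (gz _ (by rw [gsub, h, sub_self]))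
  have gbij : Function.Bijective g := by
    rw [Fintype.bijective_iff_injective_and_card]
    exact ⟨ginj, by rw [hcard]; decide⟩
  have gsurj := gbij.2
  have gR : ∀ m, inR (g m) ↔ isR m = true := by
    intro m
    rw [isR_spec]
    constructor
    · rintro ⟨h0, r, hr⟩
      obtain ⟨n, rfl⟩ := gsurj r
      exact ⟨fun h => h0 (by rw [h, g0]), n, ginj (by rw [gmul, hr])⟩
    · rintro ⟨h0, n, hn⟩
      exact ⟨fun h => h0 (gz m h), g n, by rw [← gmul, hn]⟩
  have gq : ∀ a b x y, g (qm a b x y) = qmul (g a) (g b) (g x) (g y) := by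
    intro a b x y
    unfold qm qmul
    rw [← gsub]
    by_cases h : isR (y - x) = true
    · rw [if_pos ((gR _).2 h), h, cond_true, gadd, gmul]
    · rw [if_neg (fun h' => h ((gR _).1 h')), Bool.eq_false_iff.2 h, cond_false, gadd, gmul]
  obtain ⟨a, rfl⟩ := gsurj a
  obtain ⟨b, rfl⟩ := gsurj b
  obtain ⟨h1, x, y, h2, h3⟩ := model_diag a b
    (by rw [← gR, gmul]; exact hv.1) (by rw [← gR, gmul, gsub, gsub, g1]; exact hv.2)
    (fun h => hab (by rw [h]))
  constructor
  · intro x y h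
    obtain ⟨x, rfl⟩ := gsurj x
    obtain ⟨y, rfl⟩ := gsurj y
    rw [← g0, ← gq, ← gq] at h ⊢
    rw [h1 x y (ginj h)]
  · intro h
    have := h (g x) (g y)
    rw [← g0, ← g1, ← gq, ← gq, ← gq, ← gq] at this
    exact h3 (ginj (this (by rw [h2])))

end Nine
set_option linter.unusedSectionVars false

/-! ### A counting lemma for conjugates of the translation group -/

section Counting
variable {p : ℕ} [hp : Fact p.Prime] [Algebra (ZMod p) F]

theorem card_fix_sq (σ : F ≃ₐ[ZMod p] F) (hσ : σ ≠ 1) :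
    (univ.filter fun x : F => σ x = x).card ^ 2 ≤ Fintype.card F := by
  obtain ⟨y, hy⟩ : ∃ y, σ y ≠ y := by
    by_contra! h; exact hσ (by ext x; simpa using h x)
  rw [sq, ← Finset.card_product, ← Finset.card_univ]
  refine Finset.card_le_card_of_injOn (fun k : F × F => k.1 + k.2 * y) (fun _ _ => mem_univ _) ?_
  rintro ⟨k, l⟩ h1 ⟨k', l'⟩ h2 h
  simp only [coe_product, coe_filter, mem_univ, true_and, Set.mem_prod, Set.mem_ofPred_eq] at h1 h2 h
  have hl : l = l' := by
    by_contra hne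
    have h4 := congrArg σ h
    simp only [map_add, map_mul, h1.1, h1.2, h2.1, h2.2] at h4
    have : (l - l') * (σ y - y) = 0 := by linear_combination h4 - h
    rcases mul_eq_zero.1 this with h5 | h5
    · exact hne (sub_eq_zero.1 h5)
    · exact hy (sub_eq_zero.1 h5)
  subst hl
  have : k = k' := by linear_combination h
  rw [this]

theorem sq_lt_pow (hp3 : 3 ≤ p) (d : ℕ) : d ^ 2 < p ^ d := by
  have h1 : ∀ d : ℕ, d ^ 2 < 3 ^ d := by
    intro d
    induction d with
    | zero => norm_num
    | succ d ih =>
      rcases Nat.lt_or_ge d 2 with h | h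
      · interval_cases d <;> norm_num
      · have := pow_succ 3 d; nlinarith
  exact (h1 d).trans_le (Nat.pow_le_pow_left hp3 d)

theorem lin_parts_trivial (hpo : p ≠ 2) (A : F → F →+ F) (c : F → F)
    (hinj : ∀ t, Function.Injective (A t))
    (hadd : ∀ t t' x, A (t + t') x + c (t + t') = A t (A t' x + c t') + c t)
    (hfaith : ∀ t, (∀ x, A t x + c t = x) → t = 0)
    (hmono : ∀ t, ∃ (e : F) (σ : F ≃ₐ[ZMod p] F), ∀ x, A t x = e * σ x) (t x : F) :
    A t x = x := by
  have hc : ∀ t t', c (t + t') = A t (c t') + c t := by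
    intro t t'
    have := hadd t t' 0
    simpa using this
  have hA : ∀ t t' x, A (t + t') x = A t (A t' x) := by
    intro t t' x
    have := hadd t t' x
    rw [hc, map_add] at this
    linear_combination this
  have hA0 : ∀ x, A 0 x = x := by
    intro x
    have := hA 0 0 x
    rw [add_zero] at this
    exact (hinj 0 this).symm
  have hp3 : 3 ≤ p := by have := hp.out.two_le; omega
  have hch : CharP F p := charP_of_injective_algebraMap (algebraMap (ZMod p) F).injective p
  -- scalar implies trivial
  have hscal : ∀ t k, (∀ x, A t x = k * x) → ∀ x, A t x = x := by
    intro t k hk x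
    have hn : ∀ n : ℕ, A (n • t) 1 = k ^ n := by
      intro n
      induction n with
      | zero => simp [hA0]
      | succ n ih => rw [succ_nsmul', hA, ih, hk, pow_succ']
    have h1 := hn p
    have h0 : p • t = 0 := by rw [nsmul_eq_mul, CharP.cast_eq_zero, zero_mul]
    rw [h0, hA0] at h1
    have h2 : (k - 1) ^ p = 0 := by
      rw [sub_pow_char, one_pow, ← h1, sub_self]
    have h3 : k = 1 := sub_eq_zero.1 (pow_eq_zero_iff hp.out.ne_zero |>.1 h2)
    rw [hk, h3, one_mul]
  choose e s hes using hmono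
  have he : ∀ t, e t ≠ 0 := by
    intro t h
    have h1 : A t 1 = A t 0 := by rw [hes, hes, h]; simp
    exact one_ne_zero (hinj t h1)
  let E : Finset F := univ.filter fun t => ∀ x, A t x = x
  have hfib : ∀ t t', s t = s t' → t - t' ∈ E := by
    intro t t' h
    simp only [E, mem_filter, mem_univ, true_and]
    apply hscal _ (e t / e t')
    intro x
    have h1 := hA (t - t') t' ((s t').symm (x / e t'))
    rw [sub_add_cancel, hes t, hes t', h, AlgEquiv.apply_symm_apply, mul_div_cancel₀ _ (he t')] at h1
    rw [← h1]; ring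
  have hE : Fintype.card F ≤ E.card * Module.finrank (ZMod p) F := by
    have h1 := Finset.card_le_mul_card_image (f := s) (univ : Finset F) E.card (by
      intro σ _
      rcases (univ.filter fun t => s t = σ).eq_empty_or_nonempty with h | ⟨t0, h0⟩
      · rw [h]; simp
      · simp only [mem_filter, mem_univ, true_and] at h0
        refine Finset.card_le_card_of_injOn (fun t => t - t0) ?_ ?_
        · intro t ht
          simp only [coe_filter, mem_univ, true_and, Set.mem_ofPred_eq] at ht
          exact hfib t t0 (ht.trans h0.symm)
        · intro t _ t' _ h
          exact sub_left_injective h)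
    rw [Finset.card_univ] at h1
    refine h1.trans (Nat.mul_le_mul_left _ ?_)
    rw [← card_gal]
    exact Finset.card_le_univ _
  by_contra hne
  have hs1 : s t ≠ 1 := by
    intro h
    refine hne (hscal t (e t) (fun x => ?_) x)
    rw [hes, h, AlgEquiv.one_apply]
  have hEle : E.card ≤ (univ.filter fun x : F => s t x = x).card := by
    have h1 : E.card ≤ (univ.filter fun x : F => A t x = x).card := by
      refine Finset.card_le_card_of_injOn c ?_ ?_
      · intro r hr
        simp only [E, coe_filter, mem_univ, true_and, Set.mem_ofPred_eq] at hr ⊢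
        have h1 := hc t r
        have h2 := hc r t
        rw [hr, add_comm r t] at h2
        linear_combination h2 - h1
      · intro r hr r' hr' h
        simp only [E, coe_filter, mem_univ, true_and, Set.mem_ofPred_eq] at hr hr'
        have h1 : r - r' = 0 := by
          apply hfaith
          intro x
          have h2 := hc (r - r') r'
          rw [sub_add_cancel] at h2
          have h3 : ∀ x, A (r - r') x = x := by
            intro x
            have := hA (r - r') r' x
            rw [sub_add_cancel, hr, hr'] at this
            exact this.symm
          rw [h3] at h2 ⊢
          linear_combination h - h2
        exact sub_eq_zero.1 h1
    refine h1.trans ?_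
    by_cases hx : ∃ x0, x0 ≠ 0 ∧ A t x0 = x0
    · obtain ⟨x0, h0, hx0⟩ := hx
      refine Finset.card_le_card_of_injOn (fun x => x / x0) ?_ ?_
      · intro r hr
        simp only [coe_filter, mem_univ, true_and, Set.mem_ofPred_eq] at hr ⊢
        rw [hes] at hr hx0
        rw [map_div₀]
        have hsx : s t x0 ≠ 0 := by rwa [Ne, map_eq_zero_iff _ (s t).injective]
        rw [div_eq_div_iff hsx h0]
        apply mul_left_cancel₀ (he t)
        linear_combination x0 * hr - r * hx0
      · intro r _ r' _ h
        exact (div_left_inj' h0).1 h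
    · push Not at hx
      have : (univ.filter fun x : F => A t x = x) ⊆ {0} := by
        intro x hx'
        simp only [mem_filter, mem_univ, true_and] at hx'
        rw [mem_singleton]
        by_contra h; exact hx x h hx'
      refine (Finset.card_le_card this).trans ?_
      rw [Finset.card_singleton, Nat.one_le_iff_ne_zero, Finset.card_ne_zero]
      exact ⟨0, by simp⟩
  have hK := card_fix_sq (s t) hs1
  set K := (univ.filter fun x : F => s t x = x).card
  have hlt := sq_lt_pow hp3 (Module.finrank (ZMod p) F)
  rw [← card_F (F := F)] at hlt
  set q := Fintype.card F
  set d := Module.finrank (ZMod p) F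
  have h1 : q ≤ K * d := hE.trans (Nat.mul_le_mul_right _ hEle)
  have h2 : q * q ≤ (K * d) * (K * d) := Nat.mul_le_mul h1 h1
  have h3 : (K * d) * (K * d) = K ^ 2 * d ^ 2 := by ring
  have h4 : K ^ 2 * d ^ 2 ≤ q * d ^ 2 := Nat.mul_le_mul_right _ hK
  have hq : 0 < q := Fintype.card_pos
  have h5 : q * d ^ 2 < q * q := Nat.mul_lt_mul_of_pos_left hlt hq
  omega

end Counting
set_option linter.unusedSectionVars false

/-! ### The autotopism group -/

section Atp

theorem perm_apply_inv {X : Type*} (e : Equiv.Perm X) (x : X) : e (e⁻¹ x) = x :=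
  e.apply_symm_apply x

theorem perm_inv_apply {X : Type*} (e : Equiv.Perm X) (x : X) : e⁻¹ (e x) = x :=
  e.symm_apply_apply x

/-- The autotopism group. -/
def Hgrp (a b : F) : Subgroup (Equiv.Perm F × Equiv.Perm F × Equiv.Perm F) where
  carrier := {g | ∀ x y, qmul a b (g.1 x) (g.2.1 y) = g.2.2 (qmul a b x y)}
  one_mem' := by intro x y; rfl
  mul_mem' := by
    intro g h hg hh x y
    have h1 := hg (h.1 x) (h.2.1 y)
    rw [hh x y] at h1
    exact h1
  inv_mem' := by
    intro g hg x y
    have h1 := hg (g.1⁻¹ x) (g.2.1⁻¹ y)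
    rw [perm_apply_inv, perm_apply_inv] at h1
    change qmul a b (g.1⁻¹ x) (g.2.1⁻¹ y) = g.2.2⁻¹ (qmul a b x y)
    rw [h1, perm_inv_apply]

/-- Action on cells. -/
@[reducible]
def cellAct (a b : F) : MulAction (Hgrp a b) (F × F) where
  smul g c := (g.1.1 c.1, g.1.2.1 c.2)
  one_smul _ := rfl
  mul_smul _ _ _ := rfl

/-- Diagonal translations. -/
def trHom (a b : F) : Multiplicative F →* Hgrp a b where
  toFun t := ⟨(Equiv.addLeft t.toAdd, Equiv.addLeft t.toAdd, Equiv.addLeft t.toAdd), by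
    intro x y
    simp only [Equiv.coe_addLeft, qmul_eq, add_sub_add_left_eq_sub, add_assoc]⟩
  map_one' := by
    apply Subtype.ext
    refine Prod.ext ?_ (Prod.ext ?_ ?_) <;> ext x <;> simp
  map_mul' s t := by
    apply Subtype.ext
    refine Prod.ext ?_ (Prod.ext ?_ ?_) <;> ext x <;> simp

/-- Translation group. -/
def Tgrp (a b : F) : Subgroup (Hgrp a b) := (trHom a b).range

theorem tr_one (a b t x : F) : (trHom a b (Multiplicative.ofAdd t)).1.1 x = t + x := rfl
theorem tr_two (a b t x : F) : (trHom a b (Multiplicative.ofAdd t)).1.2.1 x = t + x := rfl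
theorem tr_three (a b t x : F) : (trHom a b (Multiplicative.ofAdd t)).1.2.2 x = t + x := rfl

/-- An element normalising the translations (one-sided version). -/
theorem norm_struct (h2 : ringChar F ≠ 2) {a b : F} (hv : ValidPair a b) (hab : a ≠ b)
    (g : Hgrp a b) (hg : ∀ h ∈ Tgrp a b, g * h * g⁻¹ ∈ Tgrp a b) :
    ∃ (A : F →+ F) (c : F), Function.Injective A ∧ (∀ x, A (ph a b x) = ph a b (A x)) ∧
      (∀ x, g.1.1 x = A x + c) ∧ (∀ x, g.1.2.1 x = A x + c) ∧ (∀ x, g.1.2.2 x = A x + c) := by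
  have h1 : ∀ t, ∃ s, g * trHom a b (Multiplicative.ofAdd t) = trHom a b (Multiplicative.ofAdd s) * g := by
    intro t
    obtain ⟨s, hs⟩ := hg _ ⟨Multiplicative.ofAdd t, rfl⟩
    exact ⟨s.toAdd, by rw [ofAdd_toAdd, hs]; group⟩
  choose s hs using h1
  have e1 : ∀ t x, g.1.1 (t + x) = s t + g.1.1 x := fun t x =>
    congrArg (fun k : Hgrp a b => k.1.1 x) (hs t)
  have e2 : ∀ t x, g.1.2.1 (t + x) = s t + g.1.2.1 x := fun t x =>
    congrArg (fun k : Hgrp a b => k.1.2.1 x) (hs t)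
  have e3 : ∀ t x, g.1.2.2 (t + x) = s t + g.1.2.2 x := fun t x =>
    congrArg (fun k : Hgrp a b => k.1.2.2 x) (hs t)
  have hsadd : ∀ t t', s (t + t') = s t + s t' := by
    intro t t'
    have h3 := e1 (t + t') 0
    rw [add_assoc, e1, e1] at h3
    linear_combination -h3
  let A : F →+ F := AddMonoidHom.mk' s hsadd
  have f1 : ∀ x, g.1.1 x = A x + g.1.1 0 := fun x => by
    have := e1 x 0
    rw [add_zero] at this
    exact this
  have f2 : ∀ x, g.1.2.1 x = A x + g.1.2.1 0 := fun x => by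
    have := e2 x 0
    rw [add_zero] at this
    exact this
  have f3 : ∀ x, g.1.2.2 x = A x + g.1.2.2 0 := fun x => by
    have := e3 x 0
    rw [add_zero] at this
    exact this
  have hAinj : Function.Injective A := by
    intro x y h
    apply g.1.1.injective
    rw [f1, f1 y, h]
  have hmain : ∀ d, ph a b (A d + (g.1.2.1 0 - g.1.1 0)) = A (ph a b d) + (g.1.2.2 0 - g.1.1 0) := by
    intro d
    have h3 := g.2 0 d
    rw [qmul_eq, qmul_eq, sub_zero, zero_add, f2, f3] at h3
    rw [← add_sub_assoc]
    linear_combination h3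
  have hc := shift_zero h2 hv hab A hAinj _ _ hmain
  have hc2 : g.1.2.2 0 - g.1.1 0 = 0 := by
    have h3 := hmain 0
    rw [hc] at h3
    simpa [ph_zero] using h3.symm
  refine ⟨A, g.1.1 0, hAinj, ?_, f1, ?_, ?_⟩
  · intro d
    have h3 := hmain d
    rw [hc, hc2] at h3
    simpa using h3.symm
  · intro x; rw [f2, sub_eq_zero.1 hc]
  · intro x; rw [f3, sub_eq_zero.1 hc2]

theorem mem_norm (h2 : ringChar F ≠ 2) {a b : F} (hv : ValidPair a b) (hab : a ≠ b)
    {p : ℕ} [hp : Fact p.Prime] [Algebra (ZMod p) F] (hpo : p ≠ 2)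
    (hmono : ∀ A : F →+ F, Function.Injective A → (∀ x, A (ph a b x) = ph a b (A x)) →
      ∃ (e : F) (σ : F ≃ₐ[ZMod p] F), ∀ x, A x = e * σ x)
    (g : Hgrp a b) (hg : ∀ h ∈ Tgrp a b, g⁻¹ * h * g ∈ Subgroup.normalizer (Tgrp a b : Set (Hgrp a b))) :
    g ∈ Subgroup.normalizer (Tgrp a b : Set (Hgrp a b)) := by
  have hn : ∀ t : F, ∃ (A : F →+ F) (c : F), Function.Injective A ∧
      (∀ x, A (ph a b x) = ph a b (A x)) ∧
      (∀ x, (g⁻¹ * trHom a b (Multiplicative.ofAdd t) * g).1.1 x = A x + c) ∧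
      (∀ x, (g⁻¹ * trHom a b (Multiplicative.ofAdd t) * g).1.2.1 x = A x + c) ∧
      (∀ x, (g⁻¹ * trHom a b (Multiplicative.ofAdd t) * g).1.2.2 x = A x + c) := by
    intro t
    apply norm_struct h2 hv hab
    intro h hh
    exact (Subgroup.mem_normalizer_iff.1 (hg _ ⟨_, rfl⟩) h).1 hh
  choose A c hAinj hAph hA1 hA2 hA3 using hn
  have htriv := lin_parts_trivial hpo A c hAinj
    (by
      intro t t' x
      rw [← hA1 t', ← hA1 t, ← hA1 (t + t')]
      have : g⁻¹ * trHom a b (Multiplicative.ofAdd (t + t')) * g =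
        (g⁻¹ * trHom a b (Multiplicative.ofAdd t) * g) *
        (g⁻¹ * trHom a b (Multiplicative.ofAdd t') * g) := by
        rw [ofAdd_add, map_mul]; group
      rw [this]; rfl)
    (by
      intro t ht
      have h3 := hA1 t (g⁻¹.1.1 0)
      rw [ht] at h3
      have h4 : (g⁻¹ * trHom a b (Multiplicative.ofAdd t) * g).1.1 (g⁻¹.1.1 0) =
          (g⁻¹).1.1 (t + (g.1.1 (g⁻¹.1.1 0))) := rfl
      rw [h4] at h3
      have h5 := (g⁻¹).1.1.injective h3
      have h6 : g.1.1 (g⁻¹.1.1 0) = 0 := perm_apply_inv g.1.1 0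
      rw [h6] at h5
      simpa using h5)
    (fun t => hmono (A t) (hAinj t) (hAph t))
  rw [← inv_mem_iff]
  apply Subgroup.mem_normalizer_fintype
  rintro _ ⟨t, rfl⟩
  rw [inv_inv]
  refine ⟨Multiplicative.ofAdd (c t.toAdd), ?_⟩
  apply Subtype.ext
  refine Prod.ext ?_ (Prod.ext ?_ ?_) <;> ext x
  · rw [tr_one]
    have := hA1 t.toAdd x
    rw [htriv, ofAdd_toAdd] at this
    rw [this, add_comm]
  · rw [tr_two]
    have := hA2 t.toAdd x
    rw [htriv, ofAdd_toAdd] at this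
    rw [this, add_comm]
  · rw [tr_three]
    have := hA3 t.toAdd x
    rw [htriv, ofAdd_toAdd] at this
    rw [this, add_comm]

theorem Tgrp_pgroup (a b : F) {p : ℕ} [hp : Fact p.Prime] [Algebra (ZMod p) F] :
    IsPGroup p (Tgrp a b) := by
  have hch : CharP F p := charP_of_injective_algebraMap (algebraMap (ZMod p) F).injective p
  rintro ⟨_, t, rfl⟩
  refine ⟨1, ?_⟩
  apply Subtype.ext
  change (trHom a b t) ^ p ^ 1 = 1
  rw [← map_pow, pow_one]
  have : t ^ p = 1 := by
    rw [← ofAdd_toAdd t, ← ofAdd_nsmul, nsmul_eq_mul, CharP.cast_eq_zero, zero_mul]; rfl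
  rw [this, map_one]

theorem not_transitive_of_mono (h2 : ringChar F ≠ 2) {a b : F} (hv : ValidPair a b) (hab : a ≠ b)
    {p : ℕ} [hp : Fact p.Prime] [Algebra (ZMod p) F] (hpo : p ≠ 2)
    (hmono : ∀ A : F →+ F, Function.Injective A → (∀ x, A (ph a b x) = ph a b (A x)) →
      ∃ (e : F) (σ : F ≃ₐ[ZMod p] F), ∀ x, A x = e * σ x)
    (htr : ∀ x y : F, ∃ g : Hgrp a b, g.1.1 0 = x ∧ g.1.2.1 0 = y) : False := by
  let := cellAct a b
  set N := Subgroup.normalizer (Tgrp a b : Set (Hgrp a b)) with hN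
  set S := MulAction.stabilizer (Hgrp a b) ((0, 0) : F × F) with hS
  have hTN : Tgrp a b ≤ N := Subgroup.le_normalizer
  have hch : CharP F p := charP_of_injective_algebraMap (algebraMap (ZMod p) F).injective p
  have hSi : S.index = Nat.card F * Nat.card F := by
    rw [hS, MulAction.index_stabilizer]
    have : MulAction.orbit (Hgrp a b) ((0, 0) : F × F) = Set.univ := by
      rw [Set.eq_univ_iff_forall]
      rintro ⟨x, y⟩
      obtain ⟨g, h3, h4⟩ := htr x y
      exact ⟨g, Prod.ext h3 h4⟩
    rw [this, Set.ncard_univ, Nat.card_prod]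
  have hSN : (S ⊓ N).relIndex N = Nat.card F := by
    rw [Subgroup.inf_relIndex_right]
    have h3 : S.subgroupOf N = MulAction.stabilizer N ((0, 0) : F × F) := by
      ext n; rfl
    rw [Subgroup.relIndex, h3, MulAction.index_stabilizer]
    have : MulAction.orbit N ((0, 0) : F × F) = Set.range (fun t : F => (t, t)) := by
      ext ⟨x, y⟩
      constructor
      · rintro ⟨n, hn⟩
        obtain ⟨A, c, _, _, e1, e2, _⟩ := norm_struct h2 hv hab n.1
          (fun h hh => (Subgroup.mem_normalizer_iff.1 n.2 h).1 hh)
        refine ⟨c, ?_⟩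
        rw [← hn]
        refine Prod.ext ?_ ?_
        · have e := (e1 0).symm
          rw [map_zero, zero_add] at e
          exact e
        · have e := (e2 0).symm
          rw [map_zero, zero_add] at e
          exact e
      · rintro ⟨t, ht⟩
        refine ⟨⟨trHom a b (Multiplicative.ofAdd t), hTN ⟨_, rfl⟩⟩, ?_⟩
        rw [← ht]
        exact Prod.ext (add_zero t) (add_zero t)
    rw [this, Set.ncard_range_of_injective]
    intro s t h
    exact congrArg Prod.fst h
  have h3 := Subgroup.relIndex_mul_index (inf_le_right : S ⊓ N ≤ N)
  have h4 := Subgroup.relIndex_mul_index (inf_le_left : S ⊓ N ≤ S)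
  rw [hSN, ← h4, hSi] at h3
  have hq0 : 0 < Nat.card F := Nat.card_pos
  have h5 : N.index = (S ⊓ N).relIndex S * Nat.card F := by
    apply Nat.eq_of_mul_eq_mul_left hq0
    rw [h3]; ring
  have hpq : p ∣ Nat.card F := by
    rw [Nat.card_eq_fintype_card, card_F (p := p)]
    exact dvd_pow_self p Module.finrank_pos.ne'
  have h6 : p ∣ N.index := h5 ▸ hpq.mul_left _
  have h7 := (Tgrp_pgroup a b (p := p)).card_modEq_card_fixedPoints (Hgrp a b ⧸ N)
  have h8 : Nat.card (MulAction.fixedPoints (Tgrp a b) (Hgrp a b ⧸ N)) = 1 := by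
    rw [Nat.card_eq_one_iff_unique]
    constructor
    · constructor
      have key : ∀ z : MulAction.fixedPoints (Tgrp a b) (Hgrp a b ⧸ N), z.1 = ((1 : Hgrp a b) : Hgrp a b ⧸ N) := by
        rintro ⟨z, hz⟩
        obtain ⟨g, rfl⟩ := QuotientGroup.mk_surjective z
        have hgN : g ∈ N := by
          apply mem_norm h2 hv hab hpo hmono
          intro h hh
          have h9 := hz ⟨h⁻¹, inv_mem hh⟩
          have h10 : ((h⁻¹ * g : Hgrp a b) : Hgrp a b ⧸ N) = (g : Hgrp a b ⧸ N) := h9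
          rw [QuotientGroup.eq] at h10
          simpa [mul_assoc] using h10
        change (g : Hgrp a b ⧸ N) = _
        rw [QuotientGroup.eq]
        simpa using hgN
      intro z w
      exact Subtype.ext ((key z).trans (key w).symm)
    · refine ⟨⟨((1 : Hgrp a b) : Hgrp a b ⧸ N), ?_⟩⟩
      rintro ⟨h, hh⟩
      change ((h * 1 : Hgrp a b) : Hgrp a b ⧸ N) = ((1 : Hgrp a b) : Hgrp a b ⧸ N)
      rw [QuotientGroup.eq]
      simpa using hTN hh
  rw [h8] at h7
  have h9 : N.index ≡ 1 [MOD p] := h7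
  have h10 := (Nat.modEq_zero_iff_dvd.2 h6).symm.trans h9
  have := (Nat.modEq_zero_iff_dvd.1 h10.symm)
  exact hp.out.one_lt.ne' (Nat.dvd_one.1 this)

theorem not_transitive (h2 : ringChar F ≠ 2) {a b : F} (hv : ValidPair a b) (hab : a ≠ b)
    (htr : ∀ x y : F, ∃ g : Hgrp a b, g.1.1 0 = x ∧ g.1.2.1 0 = y) : False := by
  obtain ⟨p, hch⟩ := CharP.exists F
  have hp : Fact p.Prime := ⟨CharP.char_is_prime F p⟩
  let : Algebra (ZMod p) F := ZMod.algebra F p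
  have hpo : p ≠ 2 := by rwa [← ringChar.eq F p]
  by_cases hex : p = 3 ∧ Module.finrank (ZMod p) F = 2 ∧ (a - b) ^ 3 = -(a - b)
  · obtain ⟨rfl, hd, hv3⟩ := hex
    have hcard : Fintype.card F = 9 := by rw [card_F (p := 3), hd]; norm_num
    have hvv : (a - b) * (a - b) = -1 := by
      apply mul_left_cancel₀ (sub_ne_zero.2 hab)
      linear_combination hv3
    obtain ⟨i1, i2⟩ := nine_exception hcard hvv hv hab
    apply i2
    obtain ⟨g, h3, h4⟩ := htr 0 1
    intro x2 y2 h
    have e1 := g.2 0 (g.1.2.1⁻¹ y2)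
    have e2 := g.2 (g.1.1⁻¹ x2) 0
    have e3 := g.2 (g.1.1⁻¹ x2) (g.1.2.1⁻¹ y2)
    have e4 := g.2 0 0
    rw [perm_apply_inv] at e1 e2
    rw [perm_apply_inv, perm_apply_inv] at e3
    rw [h3] at e1 e4
    rw [h4] at e2 e4
    rw [e3, e4]
    congr 1
    apply i1
    apply g.1.2.2.injective
    rw [← e1, ← e2, h]
  · refine not_transitive_of_mono h2 hv hab hpo (fun A hinj hA => ?_) htr
    exact (monomial_lemma h2 hpo hab A hinj hA).resolve_right hex

end Atp
set_option linter.unusedSectionVars false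

/-! ### Orbits on cells and the conclusion -/

section Final

/-- The cell `(x,y)` lies in the orbit of `(0,0)`. -/
def Orb (a b x y : F) : Prop := ∃ g : Hgrp a b, g.1.1 0 = x ∧ g.1.2.1 0 = y

theorem orb_apply {a b x y : F} (g : Hgrp a b) (h : Orb a b x y) :
    Orb a b (g.1.1 x) (g.1.2.1 y) := by
  obtain ⟨k, rfl, rfl⟩ := h
  exact ⟨g * k, rfl, rfl⟩

theorem orb_apply_iff {a b x y : F} (g : Hgrp a b) :
    Orb a b (g.1.1 x) (g.1.2.1 y) ↔ Orb a b x y := by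
  refine ⟨fun h => ?_, orb_apply g⟩
  have h1 := orb_apply g⁻¹ h
  have e1 : (g⁻¹).1.1 (g.1.1 x) = x := perm_inv_apply g.1.1 x
  have e2 : (g⁻¹).1.2.1 (g.1.2.1 y) = y := perm_inv_apply g.1.2.1 y
  rwa [e1, e2] at h1

theorem orb_diag (a b x : F) : Orb a b x x :=
  ⟨trHom a b (Multiplicative.ofAdd x), by rw [tr_one, add_zero], by rw [tr_two, add_zero]⟩

/-- Affine maps with square slope are automorphisms. -/
theorem exists_affine (a b : F) {s : F} (hs : chi s = 1) (t : F) :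
    ∃ g : Hgrp a b, ∀ x, g.1.1 x = s * x + t ∧ g.1.2.1 x = s * x + t := by
  have hs0 : s ≠ 0 := by
    intro h; rw [h, chi_zero] at hs; norm_num at hs
  let e : Equiv.Perm F := (Equiv.mulLeft₀ s hs0).trans (Equiv.addRight t)
  have he : ∀ x, e x = s * x + t := fun x => rfl
  refine ⟨⟨(e, e, e), ?_⟩, fun x => ⟨he x, he x⟩⟩
  intro x y
  change qmul a b (e x) (e y) = e (qmul a b x y)
  rw [he, he, he, qmul_eq, qmul_eq]
  have : s * y + t - (s * x + t) = s * (y - x) := by ring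
  rw [this, ph_mul_sq hs]
  ring

theorem orb_chi {a b x y x' y' : F} (h : Orb a b x y) (hc : chi (y' - x') = chi (y - x)) :
    Orb a b x' y' := by
  by_cases hxy : y - x = 0
  · rw [hxy, chi_zero, chi_eq_zero, sub_eq_zero] at hc
    rw [hc]; exact orb_diag a b x'
  · have hs : chi ((y' - x') / (y - x)) = 1 := by
      have e : (y' - x') = (y' - x') / (y - x) * (y - x) := by field_simp
      rw [e, chi_mul] at hc
      have h3 := chi_sq hxy
      have h4 : chi (y - x) ≠ 0 := fun h => hxy (chi_eq_zero.1 h)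
      exact mul_right_cancel₀ h4 (by rw [hc, one_mul])
    obtain ⟨g, hg⟩ := exists_affine a b hs (x' - (y' - x') / (y - x) * x)
    have h1 := orb_apply g h
    rw [(hg x).1, (hg y).2] at h1
    convert h1 using 1
    · ring
    · field_simp
      ring

theorem Bmat_apply (η : ℤ) (x y : F) :
    Bmat F η x y = if x = y then 1 else η * chi (y - x) := by
  rw [Bmat, Matrix.add_apply, Matrix.smul_apply, Matrix.one_apply, Smat, Matrix.of_apply]
  split_ifs with h
  · rw [h, sub_self, chi_zero]; simp
  · simp

theorem pres_of_orb {a b : F} {η : ℤ} (hη : η = 1 ∨ η = -1)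
    (ho : ∀ x y, Orb a b x y ↔ x = y ∨ chi (y - x) = η) (g : Hgrp a b) :
    Pres (Bmat F η) g.1.1 g.1.2.1 := by
  have hB : ∀ x y, Bmat F η x y = if Orb a b x y then 1 else -1 := by
    intro x y
    rw [Bmat_apply]
    by_cases h : x = y
    · rw [if_pos h, if_pos ((ho x y).2 (Or.inl h))]
    · rw [if_neg h]
      have h0 : chi (y - x) ≠ 0 := fun h' => h (sub_eq_zero.1 (chi_eq_zero.1 h')).symm
      split_ifs with h1
      · rcases (ho x y).1 h1 with h2 | h2
        · exact absurd h2 h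
        · rw [h2]; rcases hη with h | h <;> rw [h] <;> norm_num
      · have h2 : chi (y - x) ≠ η := fun h' => h1 ((ho x y).2 (Or.inr h'))
        rcases hη with h | h <;> rcases chi_cases (y - x) with h3 | h3 | h3 <;>
          simp_all
  unfold Pres
  ext x y
  rw [Matrix.submatrix_apply, hB, hB, orb_apply_iff]

theorem Bmat_ph {a b : F} (hv : ValidPair a b) (η : ℤ) (x y : F) :
    Bmat F (η * chi a) x (qmul a b x y) = Bmat F η x y := by
  have ha := chi_sq hv.ne.1
  rw [Bmat_apply, Bmat_apply, qmul_eq]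
  by_cases h : x = y
  · simp [h, ph_zero]
  · rw [if_neg h, if_neg, add_sub_cancel_left, chi_ph hv]
    · linear_combination (η * chi (y - x)) * ha
    · intro h1
      have h2 : ph a b (y - x) = ph a b 0 := by
        rw [ph_zero]; linear_combination -h1
      exact h (sub_eq_zero.1 (ph_injective hv h2)).symm

theorem Bmat_sub_ph {a b : F} (hv : ValidPair a b) (η : ℤ) (x y : F) :
    Bmat F (η * chi (1 - a)) (qmul a b x y) y = Bmat F η x y := by
  have ha := chi_sq hv.ne.2.2.1
  rw [Bmat_apply, Bmat_apply, qmul_eq]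
  by_cases h : x = y
  · simp [h, ph_zero]
  · have e : y - (x + ph a b (y - x)) = (y - x) - ph a b (y - x) := by ring
    rw [if_neg h, if_neg, e, chi_sub_ph hv]
    · linear_combination (η * chi (y - x)) * ha
    · intro h1
      have h2 : (fun w => w - ph a b w) (y - x) = (fun w => w - ph a b w) 0 := by
        simp only [ph_zero]; linear_combination -h1
      exact h (sub_eq_zero.1 (sub_ph_injective hv h2)).symm

theorem one_orbital (h2 : ringChar F ≠ 2) {a b : F} (hv : ValidPair a b) (hab : a ≠ b)
    {η : ℤ} (hη : η = 1 ∨ η = -1)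
    (ho : ∀ x y, Orb a b x y ↔ x = y ∨ chi (y - x) = η) (g : Hgrp a b) :
    g.1.1 = g.1.2.1 := by
  have h1 := pres_of_orb hη ho g
  have hp : ∀ x y, Bmat F η (g.1.1 x) (g.1.2.1 y) = Bmat F η x y := by
    intro x y
    exact congrFun (congrFun h1 x) y
  have pm : ∀ c : F, c ≠ 0 → chi c = 1 ∨ chi c = -1 := by
    intro c hc
    rcases chi_cases c with h | h | h
    · exact absurd (chi_eq_zero.1 h) hc
    · exact Or.inl h
    · exact Or.inr h
  have h3 : Pres (Bmat F (η * chi a)) g.1.1 g.1.2.2 := by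
    unfold Pres
    ext x z
    obtain ⟨w, hw⟩ := (Finite.injective_iff_surjective.1 (ph_injective hv)) (z - x)
    have hz : z = qmul a b x (w + x) := by
      rw [qmul_eq, add_sub_cancel_right, hw]; ring
    rw [Matrix.submatrix_apply, hz, ← g.2 x (w + x), Bmat_ph hv, Bmat_ph hv, hp]
  have h4 : Pres (Bmat F (η * chi (1 - a))) g.1.2.2 g.1.2.1 := by
    unfold Pres
    ext z y
    obtain ⟨w, hw⟩ := (Finite.injective_iff_surjective.1 (sub_ph_injective hv)) (y - z)
    simp only at hw
    have hz : z = qmul a b (y - w) y := by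
      rw [qmul_eq, sub_sub_cancel]; linear_combination hw
    rw [Matrix.submatrix_apply, hz, ← g.2 (y - w) y, Bmat_sub_ph hv, Bmat_sub_ph hv, hp]
  refine matrix_argument h2 (three_lt_card hv hab) ?_ (pm _ hv.ne.1) (pm _ hv.ne.2.2.1) h1 h3 h4
  rcases hη with h | h <;> rw [h] <;> norm_num

theorem atp_eq (h2 : ringChar F ≠ 2) {a b : F} (hv : ValidPair a b) (hab : a ≠ b)
    (g : Hgrp a b) : g.1.1 = g.1.2.1 := by
  have key : ∀ c : ℤ, (∃ w, chi w = c ∧ Orb a b 0 w) → ∀ x y, chi (y - x) = c → Orb a b x y := by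
    rintro c ⟨w, hw, ho⟩ x y hxy
    exact orb_chi ho (by rw [hxy, sub_zero, hw])
  have key' : ∀ x y, Orb a b x y → ∃ w, chi w = chi (y - x) ∧ Orb a b 0 w := by
    intro x y h
    exact ⟨y - x, rfl, orb_chi h (by rw [sub_zero])⟩
  have tri : ∀ x y : F, x = y ∨ chi (y - x) = 1 ∨ chi (y - x) = -1 := by
    intro x y
    rcases chi_cases (y - x) with h | h | h
    · exact Or.inl (sub_eq_zero.1 (chi_eq_zero.1 h)).symm
    · exact Or.inr (Or.inl h)
    · exact Or.inr (Or.inr h)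
  by_cases h1 : ∃ w, chi w = 1 ∧ Orb a b 0 w <;> by_cases h3 : ∃ w, chi w = -1 ∧ Orb a b 0 w
  · exfalso
    refine not_transitive h2 hv hab fun x y => ?_
    rcases tri x y with h | h | h
    · rw [h]; exact orb_diag a b y
    · exact key 1 h1 x y h
    · exact key (-1) h3 x y h
  · refine one_orbital h2 hv hab (Or.inl rfl) (fun x y => ⟨fun h => ?_, fun h => ?_⟩) g
    · rcases tri x y with h' | h' | h'
      · exact Or.inl h'
      · exact Or.inr h'
      · have := key' x y h
        rw [h'] at this
        exact absurd this h3
    · rcases h with h | h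
      · rw [h]; exact orb_diag a b y
      · exact key 1 h1 x y h
  · refine one_orbital h2 hv hab (Or.inr rfl) (fun x y => ⟨fun h => ?_, fun h => ?_⟩) g
    · rcases tri x y with h' | h' | h'
      · exact Or.inl h'
      · have := key' x y h
        rw [h'] at this
        exact absurd this h1
      · exact Or.inr h'
    · rcases h with h | h
      · rw [h]; exact orb_diag a b y
      · exact key (-1) h3 x y h
  · ext x
    have h := orb_apply g (orb_diag a b x)
    rcases tri (g.1.1 x) (g.1.2.1 x) with h' | h' | h'
    · exact h'
    · have := key' _ _ h
      rw [h'] at this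
      exact absurd this h1
    · have := key' _ _ h
      rw [h'] at this
      exact absurd this h3

end Final

/-- If `(a,b)` is a valid pair with `a ≠ b`, then every autotopism of the quadratic
quasigroup `Q_{a,b}` is an automorphism. -/
theorem autotopism_of_quadratic_quasigroup_is_automorphism
    (hodd : Odd (Fintype.card F)) (a b : F) (hv : ValidPair a b) (hab : a ≠ b)
    (α β γ : Equiv.Perm F)
    (hatp : ∀ x y : F, qmul a b (α x) (β y) = γ (qmul a b x y)) :
    α = β ∧ β = γ := by
  have h2 : ringChar F ≠ 2 := by
    intro h
    have h1 := FiniteField.even_card_iff_char_two.1 h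
    rw [Nat.odd_iff] at hodd
    omega
  have h : α = β := atp_eq h2 hv hab (⟨(α, β, γ), hatp⟩ : Hgrp a b)
  refine ⟨h, ?_⟩
  ext x
  have h3 := hatp x x
  rw [h, qmul_eq, qmul_eq, sub_self, sub_self, ph_zero, add_zero, add_zero] at h3
  exact h3
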